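/- arXiv:2603.07439 — 13 statements merged into one kernel-verified Lean document; each statement's English description precedes it below -/
import Mathlib

section
/- Let d be a degree sequence and let F and F' be two forests on the same finite vertex set V with deg_F(v) = deg_{F'}(v) for every v ∈ V. Then there exists a finite sequence of graphs F = G_0, G_1, ..., G_r = F' on V such that every G_i is a forest and, for each i, G_{i+1} is obtained from G_i by a 2-switch. (Equivalently, the subgraph F(d) of the realization graph induced by forests is connected.) -/
open SimpleGraph

variable {V : Type*}

/-- The graph obtained from `G` by the 2-switch deleting the edges `ab`, `cd`
and adding the edges `ac`, `bd`. -/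
def switched (G : SimpleGraph V) (a b c d : V) : SimpleGraph V :=
  SimpleGraph.fromEdgeSet ((G.edgeSet \ {s(a, b), s(c, d)}) ∪ {s(a, c), s(b, d)})

/-- `a, b, c, d` form a valid 2-switch configuration in `G`: they are four distinct
vertices with `ab, cd ∈ E(G)` and `ac, bd ∉ E(G)`. -/
def IsSwitchPair (G : SimpleGraph V) (a b c d : V) : Prop :=
  a ≠ b ∧ a ≠ c ∧ a ≠ d ∧ b ≠ c ∧ b ≠ d ∧ c ≠ d ∧
    G.Adj a b ∧ G.Adj c d ∧ ¬ G.Adj a c ∧ ¬ G.Adj b d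

/-- `H` is obtained from `G` by a 2-switch. -/
def TwoSwitch (G H : SimpleGraph V) : Prop :=
  ∃ a b c d : V, IsSwitchPair G a b c d ∧ H = switched G a b c d

/-- `s` is the edge set of some cycle of `G`. -/
def IsCycleEdgeSet (G : SimpleGraph V) (s : Set (Sym2 V)) : Prop :=
  ∃ (v : V) (w : G.Walk v v), w.IsCycle ∧ s = {e | e ∈ w.edges}

/-- Every connected component of `G` contains at most one cycle: any two cycles
lying in the same component have the same edge set. -/
def IsPseudoforest (G : SimpleGraph V) : Prop :=
  ∀ (u v : V) (p : G.Walk u u) (q : G.Walk v v),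
    p.IsCycle → q.IsCycle → G.Reachable u v → {e | e ∈ p.edges} = {e | e ∈ q.edges}

/-- `G` is connected and contains exactly one cycle. -/
def IsUnicyclic (G : SimpleGraph V) : Prop :=
  G.Connected ∧ ∃! s : Set (Sym2 V), IsCycleEdgeSet G s

/-- The number of connected components of `G`. -/
noncomputable def kappa (G : SimpleGraph V) : ℕ :=
  Nat.card G.ConnectedComponent

/-- The number of connected components of `G` containing a cycle. -/
noncomputable def cyc (G : SimpleGraph V) : ℕ :=
  Nat.card {C : G.ConnectedComponent // ∃ (v : V) (w : G.Walk v v),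
    G.connectedComponentMk v = C ∧ w.IsCycle}

section Leaf

variable {G : SimpleGraph V}

/-- `l` is a vertex whose only neighbour in `G` is `u`. -/
def IsLeafAt (G : SimpleGraph V) (l u : V) : Prop :=
  ∀ w, G.Adj l w ↔ w = u

theorem exists_isLeafAt [Finite V] (hG : G.IsAcyclic) {x y : V} (hxy : G.Adj x y) :
    ∃ l u, IsLeafAt G l u := by
  have : Nonempty V := ⟨x⟩
  obtain ⟨l, v, p, hp, hmax⟩ := Walk.exists_isPath_forall_isPath_length_le_length G
  have hlen : 1 ≤ p.length := hmax x y hxy.toWalk (by simp [hxy.ne])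
  have hnil : ¬ p.Nil := by
    rw [← Walk.length_eq_zero_iff]
    lia
  refine ⟨l, p.snd, fun w => ⟨fun hw => hG.eq_snd_of_adj_start hp hw ?_, ?_⟩⟩
  · by_contra hmem
    have := hmax w v (.cons hw.symm p) (hp.cons hmem)
    simp at this
  · rintro rfl
    exact p.adj_snd hnil

theorem not_reachable_of_forall_not_adj {l w : V} (hl : ∀ v, ¬ G.Adj l v) (hne : l ≠ w) :
    ¬ G.Reachable l w := by
  rintro ⟨p⟩
  cases p with
  | nil => exact hne rfl
  | cons h _ => exact hl _ h

theorem isLeafAt_of_ncard_eq [Finite V] {H : SimpleGraph V} {l u : V} (hl : IsLeafAt G l u)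
    (h : (G.neighborSet l).ncard = (H.neighborSet l).ncard) : ∃ w, IsLeafAt H l w := by
  have hG : G.neighborSet l = {u} := by
    ext w
    simp [hl w]
  rw [hG, Set.ncard_singleton, eq_comm, Set.ncard_eq_one] at h
  obtain ⟨w, hw⟩ := h
  exact ⟨w, fun v => by rw [← mem_neighborSet, hw, Set.mem_singleton_iff]⟩

/-- In a forest, a vertex that reaches `x` without using the edge `wx` has a path to `w`
whose last edge is `xw`. -/
theorem exists_isPath_penultimate_eq (hG : G.IsAcyclic) {u w x : V} (hwx : G.Adj w x)
    (h : (G.deleteEdges {s(w, x)}).Reachable u x) :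
    ∃ p : G.Walk u w, p.IsPath ∧ p.penultimate = x := by
  classical
  obtain ⟨p, hp⟩ := h.exists_isPath
  have hw : w ∉ p.support := fun hmem =>
    isBridge_iff.mp (isAcyclic_iff_forall_adj_isBridge.mp hG hwx) ⟨p.dropUntil w hmem⟩
  have hle := G.deleteEdges_le {s(w, x)}
  refine ⟨(p.mapLe hle).concat hwx.symm, (hp.mapLe hle).concat ?_ _, by simp⟩
  simpa using hw

theorem eq_of_reachable_deleteEdges (hG : G.IsAcyclic) {u w x y : V}
    (hwx : G.Adj w x) (hwy : G.Adj w y)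
    (hx : (G.deleteEdges {s(w, x)}).Reachable u x)
    (hy : (G.deleteEdges {s(w, y)}).Reachable u y) : x = y := by
  obtain ⟨p, hp, rfl⟩ := exists_isPath_penultimate_eq hG hwx hx
  obtain ⟨q, hq, rfl⟩ := exists_isPath_penultimate_eq hG hwy hy
  rw [Subtype.mk.inj ((hG.subsingleton_path u w).elim ⟨p, hp⟩ ⟨q, hq⟩)]

end Leaf

section Switch

variable {G H : SimpleGraph V} {a b c d : V}

theorem switched_adj {x y : V} : (switched G a b c d).Adj x y ↔
    ((G.Adj x y ∧ ¬ (x = a ∧ y = b ∨ x = b ∧ y = a) ∧ ¬ (x = c ∧ y = d ∨ x = d ∧ y = c)) ∨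
      (x = a ∧ y = c ∨ x = c ∧ y = a) ∨ (x = b ∧ y = d ∨ x = d ∧ y = b)) ∧ x ≠ y := by
  simp only [switched, fromEdgeSet_adj, Set.mem_union, Set.mem_sdiff, mem_edgeSet,
    Set.mem_insert_iff, Set.mem_singleton_iff, Sym2.eq_iff, not_or]

theorem IsSwitchPair.swap (h : IsSwitchPair G a b c d) : IsSwitchPair G b a d c := by
  obtain ⟨h1, h2, h3, h4, h5, h6, h7, h8, h9, h10⟩ := h
  exact ⟨h1.symm, h5, h4, h3, h2, h6.symm, h7.symm, h8.symm, h10, h9⟩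

theorem IsSwitchPair.rotate (h : IsSwitchPair G a b c d) : IsSwitchPair G c d a b := by
  obtain ⟨h1, h2, h3, h4, h5, h6, h7, h8, h9, h10⟩ := h
  exact ⟨h6, h2.symm, h4.symm, h3.symm, h5.symm, h1, h8, h7, fun h => h9 h.symm,
    fun h => h10 h.symm⟩

theorem switched_swap : switched G a b c d = switched G b a d c := by
  rw [switched, switched, Sym2.eq_swap (a := b) (b := a), Sym2.eq_swap (a := d) (b := c),
    Set.pair_comm s(b, d)]

theorem switched_rotate : switched G a b c d = switched G c d a b := by
  rw [switched, switched, Sym2.eq_swap (a := c) (b := a), Sym2.eq_swap (a := d) (b := b),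
    Set.pair_comm s(c, d)]

theorem IsSwitchPair.ncard_neighborSet_switched_fst [Finite V] (h : IsSwitchPair G a b c d) :
    ((switched G a b c d).neighborSet a).ncard = (G.neighborSet a).ncard := by
  obtain ⟨h1, h2, h3, h4, h5, h6, h7, h8, h9, h10⟩ := h
  have : (switched G a b c d).neighborSet a = insert c (G.neighborSet a \ {b}) := by
    ext w
    simp only [mem_neighborSet, switched_adj, Set.mem_insert_iff, Set.mem_sdiff,
      Set.mem_singleton_iff]
    grind [SimpleGraph.Adj.ne]
  rw [this]
  exact Set.ncard_exchange h9 h7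

theorem IsSwitchPair.ncard_neighborSet_switched [Finite V] (h : IsSwitchPair G a b c d) (v : V) :
    ((switched G a b c d).neighborSet v).ncard = (G.neighborSet v).ncard := by
  by_cases ha : v = a
  · exact ha ▸ h.ncard_neighborSet_switched_fst
  by_cases hb : v = b
  · rw [switched_swap]
    exact hb ▸ h.swap.ncard_neighborSet_switched_fst
  by_cases hc : v = c
  · rw [switched_rotate]
    exact hc ▸ h.rotate.ncard_neighborSet_switched_fst
  by_cases hd : v = d
  · rw [switched_swap, switched_rotate]
    exact hd ▸ h.swap.rotate.ncard_neighborSet_switched_fst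
  congr 1
  ext w
  simp only [mem_neighborSet, switched_adj]
  grind [SimpleGraph.Adj.ne]

theorem TwoSwitch.ncard_neighborSet [Finite V] (h : TwoSwitch G H) (v : V) :
    (H.neighborSet v).ncard = (G.neighborSet v).ncard := by
  obtain ⟨a, b, c, d, h, rfl⟩ := h
  exact h.ncard_neighborSet_switched v

theorem TwoSwitch.symm (h : TwoSwitch G H) : TwoSwitch H G := by
  obtain ⟨a, b, c, d, ⟨h1, h2, h3, h4, h5, h6, h7, h8, h9, h10⟩, rfl⟩ := h
  refine ⟨a, c, b, d, ⟨h2, h1, h3, h4.symm, h6, h5, ?_, ?_, ?_, ?_⟩, ?_⟩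
  · simp [switched_adj, h2]
  · simp [switched_adj, h5]
  · rw [switched_adj]
    grind
  · rw [switched_adj]
    grind
  · ext x y
    simp only [switched_adj]
    grind [SimpleGraph.Adj.ne, SimpleGraph.Adj.symm]

theorem TwoSwitch.sup_edge {l u : V} (h : TwoSwitch G H) (hl : ∀ v, ¬ G.Adj l v) :
    TwoSwitch (G ⊔ edge l u) (H ⊔ edge l u) := by
  obtain ⟨a, b, c, d, ⟨h1, h2, h3, h4, h5, h6, h7, h8, h9, h10⟩, rfl⟩ := h
  have ha : l ≠ a := by rintro rfl; exact hl _ h7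
  have hb : l ≠ b := by rintro rfl; exact hl _ h7.symm
  have hc : l ≠ c := by rintro rfl; exact hl _ h8
  have hd : l ≠ d := by rintro rfl; exact hl _ h8.symm
  refine ⟨a, b, c, d, ⟨h1, h2, h3, h4, h5, h6, .inl h7, .inl h8, ?_, ?_⟩, ?_⟩
  · rw [sup_adj, edge_adj]
    grind
  · rw [sup_adj, edge_adj]
    grind
  · ext x y
    simp only [switched_adj, sup_adj, edge_adj]
    grind

end Switch

/-- `H` is obtained from `G` by a 2-switch, and both graphs are forests. -/
def ForestSwitch (G H : SimpleGraph V) : Prop :=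
  G.IsAcyclic ∧ H.IsAcyclic ∧ TwoSwitch G H

section ForestSwitch

open Relation

variable {G H : SimpleGraph V}

instance : Std.Symm (ForestSwitch (V := V)) :=
  ⟨fun _ _ h => ⟨h.2.1, h.1, h.2.2.symm⟩⟩

theorem ncard_neighborSet_of_reflTransGen [Finite V] (h : ReflTransGen ForestSwitch G H) (v : V) :
    (H.neighborSet v).ncard = (G.neighborSet v).ncard := by
  induction h with
  | refl => rfl
  | tail _ h ih => rw [h.2.2.ncard_neighborSet, ih]

theorem isAcyclic_of_reflTransGen (hG : G.IsAcyclic) (h : ReflTransGen ForestSwitch G H) :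
    H.IsAcyclic := by
  cases h with
  | refl => exact hG
  | tail _ h => exact h.2.1

theorem forall_not_adj_iff_ncard [Finite V] {l : V} :
    (∀ v, ¬ G.Adj l v) ↔ (G.neighborSet l).ncard = 0 := by
  rw [Set.ncard_eq_zero, Set.eq_empty_iff_forall_notMem]
  rfl

theorem reflTransGen_sup_edge [Finite V] {l u : V} (hlu : l ≠ u) (hl : ∀ v, ¬ G.Adj l v)
    (h : ReflTransGen ForestSwitch G H) :
    ReflTransGen ForestSwitch (G ⊔ edge l u) (H ⊔ edge l u) := by
  induction h with
  | refl => exact .refl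
  | @tail H K h hHK ih =>
    have hH : ∀ v, ¬ H.Adj l v := by
      rwa [forall_not_adj_iff_ncard, ncard_neighborSet_of_reflTransGen h,
        ← forall_not_adj_iff_ncard]
    have hK : ∀ v, ¬ K.Adj l v := by
      rwa [forall_not_adj_iff_ncard, hHK.2.2.ncard_neighborSet, ← forall_not_adj_iff_ncard]
    exact ih.tail ⟨hHK.1.sup_edge_of_not_reachable (not_reachable_of_forall_not_adj hH hlu),
      hHK.2.1.sup_edge_of_not_reachable (not_reachable_of_forall_not_adj hK hlu),
      hHK.2.2.sup_edge hH⟩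

/-- A leaf at `u` can be moved to `w` by a 2-switch through a neighbour `x` of `w` that is
separated from `u` by the edge `wx`. -/
theorem exists_forestSwitch_isLeafAt (hG : G.IsAcyclic) {l u w x : V} (hl : IsLeafAt G l u)
    (huw : u ≠ w) (hlw : l ≠ w) (hwx : G.Adj w x)
    (h : ¬ (G.deleteEdges {s(w, x)}).Reachable u x) :
    ∃ H, ForestSwitch G H ∧ IsLeafAt H l w := by
  have hlu : G.Adj l u := (hl u).2 rfl
  have hlx : l ≠ x := by
    rintro rfl
    exact huw ((hl w).1 hwx.symm).symm
  have hux : u ≠ x := by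
    rintro rfl
    exact h .rfl
  have hnux : ¬ G.Adj u x := fun hux' => h <| Adj.reachable <| by
    rw [deleteEdges_adj, Set.mem_singleton_iff, Sym2.eq_iff]
    grind
  have hnlw : ¬ G.Adj l w := fun h => huw ((hl w).1 h).symm
  refine ⟨switched G l u w x, ⟨hG, ?_, l, u, w, x,
    ⟨hlu.ne, hlw, hlx, huw, hux, hwx.ne, hlu, hwx, hnlw, hnux⟩, rfl⟩, fun v => ?_⟩
  · have hac : (G.deleteEdges {s(l, u), s(w, x)} ⊔ edge u x).IsAcyclic := by
      refine (hG.anti (deleteEdges_le _)).sup_edge_of_not_reachable fun hr => h (hr.mono ?_)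
      exact deleteEdges_anti (by simp)
    refine (hac.sup_edge_of_not_reachable
      (not_reachable_of_forall_not_adj (w := w) (l := l) (fun v => ?_) hlw)).anti fun v v' => ?_
    · have := hl v
      simp only [sup_adj, deleteEdges_adj, edge_adj, Set.mem_insert_iff, Set.mem_singleton_iff,
        Sym2.eq_iff]
      grind [hlu.ne]
    · simp only [switched_adj, sup_adj, deleteEdges_adj, edge_adj, Set.mem_insert_iff,
        Set.mem_singleton_iff, Sym2.eq_iff]
      grind
  · have := hl v
    simp only [switched_adj]
    grind [hlu.ne]

/-- If the leaf at `u` cannot be moved to `w` by a 2-switch of forests, then `w` has degree at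
most one. -/
theorem eq_of_forall_not_forestSwitch (hG : G.IsAcyclic) {l u w : V} (hl : IsLeafAt G l u)
    (huw : u ≠ w) (hlw : l ≠ w) (h : ¬ ∃ H, ForestSwitch G H ∧ IsLeafAt H l w)
    {x y : V} (hx : G.Adj w x) (hy : G.Adj w y) : x = y := by
  refine eq_of_reachable_deleteEdges hG (u := u) hx hy ?_ ?_ <;> by_contra hr
  · exact h (exists_forestSwitch_isLeafAt hG hl huw hlw hx hr)
  · exact h (exists_forestSwitch_isLeafAt hG hl huw hlw hy hr)

theorem exists_forestSwitch_of_isLeafAt_of_isLeafAt (hG : G.IsAcyclic) {l u w x : V}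
    (hl : IsLeafAt G l u) (hu : IsLeafAt G u l) (huw : u ≠ w) (hlw : l ≠ w) (hwx : G.Adj w x) :
    ∃ H, ForestSwitch G H ∧ IsLeafAt H l w := by
  refine exists_forestSwitch_isLeafAt hG hl huw hlw hwx fun hr => ?_
  have hclosed : ∀ {a b : V}, G.Walk a b → (a = l ∨ a = u) → (b = l ∨ b = u) := by
    intro a b p
    induction p with
    | nil => exact id
    | cons h _ ih =>
      rintro (rfl | rfl)
      · exact ih (.inr ((hl _).1 h))
      · exact ih (.inl ((hu _).1 h))
  obtain ⟨p⟩ := hr.mono (deleteEdges_le _)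
  rcases hclosed p (.inr rfl) with rfl | rfl
  · exact huw ((hl w).1 hwx.symm).symm
  · exact hlw ((hu w).1 hwx.symm).symm

theorem exists_common_isLeafAt [Finite V] (hG : G.IsAcyclic) (hH : H.IsAcyclic)
    (hdeg : ∀ v, (G.neighborSet v).ncard = (H.neighborSet v).ncard) {l u w : V}
    (hl : IsLeafAt G l u) (hl' : IsLeafAt H l w) :
    ∃ G' H' z, ReflTransGen ForestSwitch G G' ∧ ReflTransGen ForestSwitch H H' ∧
      IsLeafAt G' l z ∧ IsLeafAt H' l z := by
  obtain rfl | huw := eq_or_ne u w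
  · exact ⟨G, H, u, .refl, .refl, hl, hl'⟩
  have hlu : G.Adj l u := (hl u).2 rfl
  have hlw : H.Adj l w := (hl' w).2 rfl
  by_cases h : ∃ G', ForestSwitch G G' ∧ IsLeafAt G' l w
  · obtain ⟨G', hGG', hG'⟩ := h
    exact ⟨G', H, w, .single hGG', .refl, hG', hl'⟩
  · have hw : IsLeafAt H w l := by
      have hle : (H.neighborSet w).ncard ≤ 1 := by
        rw [← hdeg, Set.ncard_le_one]
        exact fun x hx y hy => eq_of_forall_not_forestSwitch hG hl huw hlw.ne h hx hy
      rw [Set.ncard_le_one] at hle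
      exact fun v => ⟨fun hv => hle v hv l hlw.symm, fun hv => hv ▸ hlw.symm⟩
    have hu : (H.neighborSet u).Nonempty := by
      rw [← Set.ncard_pos, ← hdeg, Set.ncard_pos]
      exact ⟨l, hlu.symm⟩
    obtain ⟨x, hx⟩ := hu
    obtain ⟨H', hHH', hH'⟩ :=
      exists_forestSwitch_of_isLeafAt_of_isLeafAt hH hl' hw huw.symm hlu.ne hx
    exact ⟨G, H', u, .refl, .single hHH', hl, hH'⟩

theorem ncard_neighborSet_deleteEdges [Finite V] {l u : V} (h : G.Adj l u) (v : V) :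
    ((G.deleteEdges {s(l, u)}).neighborSet v).ncard =
      (G.neighborSet v).ncard - {w | s(v, w) = s(l, u)}.ncard := by
  rw [← Set.ncard_sdiff]
  · congr 1
    ext w
    simp
  · intro w (hw : s(v, w) = s(l, u))
    rwa [mem_neighborSet, ← mem_edgeSet, hw]

theorem deleteEdges_sup_edge {l u : V} (h : G.Adj l u) :
    G.deleteEdges {s(l, u)} ⊔ edge l u = G := by
  ext x y
  simp only [sup_adj, deleteEdges_adj, edge_adj, Set.mem_singleton_iff, Sym2.eq_iff]
  grind [h.symm, h.ne]

theorem IsLeafAt.not_adj_deleteEdges {l u : V} (h : IsLeafAt G l u) (v : V) :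
    ¬ (G.deleteEdges {s(l, u)}).Adj l v := by
  rw [deleteEdges_adj, h v]
  rintro ⟨rfl, h⟩
  exact h rfl

theorem reflTransGen_forestSwitch [Fintype V] (hG : G.IsAcyclic) (hH : H.IsAcyclic)
    (hdeg : ∀ v, (G.neighborSet v).ncard = (H.neighborSet v).ncard) :
    ReflTransGen ForestSwitch G H := by
  induction hn : ∑ v, (G.neighborSet v).ncard using Nat.strong_induction_on generalizing G H with
  | _ n ih =>
  by_cases hbot : ∃ x y, G.Adj x y
  · obtain ⟨x, y, hxy⟩ := hbot
    obtain ⟨l, u, hl⟩ := exists_isLeafAt hG hxy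
    obtain ⟨w, hl'⟩ := isLeafAt_of_ncard_eq hl (hdeg l)
    obtain ⟨G', H', z, hGG', hHH', hz, hz'⟩ := exists_common_isLeafAt hG hH hdeg hl hl'
    have hG' := isAcyclic_of_reflTransGen hG hGG'
    have hH' := isAcyclic_of_reflTransGen hH hHH'
    have hlz : G'.Adj l z := (hz z).2 rfl
    have hlz' : H'.Adj l z := (hz' z).2 rfl
    have hlt : ∑ v, ((G'.deleteEdges {s(l, z)}).neighborSet v).ncard < n := by
      simp_rw [← hn, ← ncard_neighborSet_of_reflTransGen hGG']
      refine Finset.sum_lt_sum (fun v _ => ?_) ⟨l, Finset.mem_univ l, ?_⟩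
      · rw [ncard_neighborSet_deleteEdges hlz]
        exact Nat.sub_le _ _
      · rw [forall_not_adj_iff_ncard.mp hz.not_adj_deleteEdges, Set.ncard_pos]
        exact ⟨z, hlz⟩
    have key := ih _ hlt (hG'.anti (deleteEdges_le _))
      (hH'.anti (deleteEdges_le {s(l, z)})) (fun v => by
        rw [ncard_neighborSet_deleteEdges hlz, ncard_neighborSet_deleteEdges hlz',
          ncard_neighborSet_of_reflTransGen hGG', ncard_neighborSet_of_reflTransGen hHH', hdeg])
      rfl
    have hlift := reflTransGen_sup_edge hlz.ne hz.not_adj_deleteEdges key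
    rw [deleteEdges_sup_edge hlz, deleteEdges_sup_edge hlz'] at hlift
    exact (hGG'.trans hlift).trans (Std.Symm.symm _ _ hHH')
  · push Not at hbot
    have hGH : G = H := by
      ext x y
      have hx := hbot x
      rw [forall_not_adj_iff_ncard, hdeg, ← forall_not_adj_iff_ncard] at hx
      exact iff_of_false (hbot x y) (hx y)
    rw [hGH]

end ForestSwitch

/-- Any two forests on the same finite vertex set with the same degree
sequence are connected by a sequence of 2-switches all of whose intermediate graphs
are forests. -/
theorem forests_connected_by_2switches {V : Type*} [Fintype V]
    (F F' : SimpleGraph V) (hF : F.IsAcyclic) (hF' : F'.IsAcyclic)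
    (hdeg : ∀ v : V, (F.neighborSet v).ncard = (F'.neighborSet v).ncard) :
    ∃ (r : ℕ) (Gs : Fin (r + 1) → SimpleGraph V),
      Gs 0 = F ∧ Gs (Fin.last r) = F' ∧
      (∀ i, (Gs i).IsAcyclic) ∧
      (∀ i : Fin r, TwoSwitch (Gs i.castSucc) (Gs i.succ)) := by
  have h := reflTransGen_forestSwitch hF hF' hdeg
  clear hdeg
  induction h using Relation.ReflTransGen.head_induction_on with
  | refl => exact ⟨0, fun _ => F', rfl, rfl, fun _ => hF', fun i => i.elim0⟩
  | @head G H h _ ih =>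
    obtain ⟨r, Gs, h0, hlast, hac, hsw⟩ := ih h.2.1
    refine ⟨r + 1, Fin.cons G Gs, rfl, by rw [← Fin.succ_last, Fin.cons_succ, hlast], ?_, ?_⟩
    · exact Fin.cases h.1 hac
    · refine Fin.cases ?_ fun i => ?_
      · simpa [h0] using h.2.2
      · simpa [← Fin.succ_castSucc] using hsw i
end

section
/- Let G be a simple graph on a finite vertex set and let τ be a 2-switch on G. Then |μ(τ(G)) − μ(G)| ≤ 1, where μ denotes the matching number. That is, the matching number is stable under 2-switch. -/
open SimpleGraph

variable {V : Type*}

/-- A matching of `G`: a set of edges of `G`, no two of which share a vertex. -/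
def IsMatchingSet (G : SimpleGraph V) (M : Set (Sym2 V)) : Prop :=
  M ⊆ G.edgeSet ∧ ∀ e ∈ M, ∀ f ∈ M, e ≠ f → ∀ v : V, v ∈ e → v ∉ f

/-- The matching number of `G`: the maximum size of a matching of `G`. -/
noncomputable def matchingNumber {V : Type*} [Fintype V] (G : SimpleGraph V) : ℕ :=
  sSup {n : ℕ | ∃ M : Set (Sym2 V), IsMatchingSet G M ∧ M.ncard = n}

theorem IsMatchingSet.subset {G H : SimpleGraph V} {M N : Set (Sym2 V)}
    (hM : IsMatchingSet G M) (hN : N ⊆ M) (hH : N ⊆ H.edgeSet) : IsMatchingSet H N :=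
  ⟨hH, fun e he f hf => hM.2 e (hN he) f (hN hf)⟩

/-- Two edges of a graph can be deleted at the cost of one matching edge, provided that an edge
joining their endpoints is available in the new graph. -/
theorem IsMatchingSet.exists_ncard_le_succ [Finite V] {G H : SimpleGraph V} {a b c d : V}
    (hbc : b ≠ c) (hac : H.Adj a c)
    (hH : ∀ e ∈ G.edgeSet, e ≠ s(a, b) → e ≠ s(c, d) → e ∈ H.edgeSet)
    {M : Set (Sym2 V)} (hM : IsMatchingSet G M) :
    ∃ N, IsMatchingSet H N ∧ M.ncard ≤ N.ncard + 1 := by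
  by_cases hab : s(a, b) ∈ M
  · by_cases hcd : s(c, d) ∈ M
    · have ha : ∀ f ∈ M, f ≠ s(a, b) → a ∉ f := fun f hf hne =>
        hM.2 _ hab f hf hne.symm a (Sym2.mem_mk_left a b)
      have hc : ∀ f ∈ M, f ≠ s(c, d) → c ∉ f := fun f hf hne =>
        hM.2 _ hcd f hf hne.symm c (Sym2.mem_mk_left c d)
      have hnot : s(a, c) ∉ (M \ {s(a, b)}) \ {s(c, d)} := fun h =>
        ha _ h.1.1 h.1.2 (Sym2.mem_mk_left a c)
      refine ⟨insert s(a, c) ((M \ {s(a, b)}) \ {s(c, d)}), ⟨?_, ?_⟩, ?_⟩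
      · rintro e (rfl | he)
        · exact hac
        · exact hH e (hM.1 he.1.1) he.1.2 he.2
      · have key : ∀ f ∈ (M \ {s(a, b)}) \ {s(c, d)}, ∀ v ∈ s(a, c), v ∉ f := by
          intro f hf v hv
          rcases Sym2.mem_iff.1 hv with rfl | rfl
          · exact ha f hf.1.1 hf.1.2
          · exact hc f hf.1.1 hf.2
        rintro e (rfl | he) f (rfl | hf) hef v hve hvf
        · exact hef rfl
        · exact key f hf v hve hvf
        · exact key e he v hvf hve
        · exact hM.2 e he.1.1 f hf.1.1 hef v hve hvf
      · rw [Set.ncard_insert_of_notMem hnot]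
        have h₁ := Set.ncard_le_ncard_sdiff_add_ncard M {s(a, b)}
        have h₂ := Set.ncard_le_ncard_sdiff_add_ncard (M \ {s(a, b)}) {s(c, d)}
        rw [Set.ncard_singleton] at h₁ h₂
        omega
    · refine ⟨M \ {s(a, b)}, hM.subset Set.sdiff_subset fun e he =>
        hH e (hM.1 he.1) he.2 (ne_of_mem_of_not_mem he.1 hcd), ?_⟩
      simpa using Set.ncard_le_ncard_sdiff_add_ncard M {s(a, b)}
  · refine ⟨M \ {s(c, d)}, hM.subset Set.sdiff_subset fun e he =>
      hH e (hM.1 he.1) (ne_of_mem_of_not_mem he.1 hab) he.2, ?_⟩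
    simpa using Set.ncard_le_ncard_sdiff_add_ncard M {s(c, d)}

theorem bddAbove_matching_ncard [Finite V] (G : SimpleGraph V) :
    BddAbove {n : ℕ | ∃ M : Set (Sym2 V), IsMatchingSet G M ∧ M.ncard = n} := by
  refine ⟨Nat.card (Sym2 V), ?_⟩
  rintro n ⟨M, -, rfl⟩
  exact Set.ncard_le_card M

theorem matchingNumber_le_succ [Fintype V] {G H : SimpleGraph V} {a b c d : V}
    (hbc : b ≠ c) (hac : H.Adj a c)
    (hH : ∀ e ∈ G.edgeSet, e ≠ s(a, b) → e ≠ s(c, d) → e ∈ H.edgeSet) :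
    matchingNumber G ≤ matchingNumber H + 1 := by
  refine csSup_le' ?_
  rintro n ⟨M, hM, rfl⟩
  obtain ⟨N, hN, hle⟩ := hM.exists_ncard_le_succ hbc hac hH
  exact hle.trans (Nat.add_le_add_right (le_csSup (bddAbove_matching_ncard H) ⟨N, hN, rfl⟩) 1)

theorem mem_edgeSet_switched {G : SimpleGraph V} {a b c d : V} (hac : a ≠ c) (hbd : b ≠ d)
    {e : Sym2 V} : e ∈ (switched G a b c d).edgeSet ↔
      (e ∈ G.edgeSet ∧ e ≠ s(a, b) ∧ e ≠ s(c, d)) ∨ e = s(a, c) ∨ e = s(b, d) := by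
  have hdiag : e ∈ G.edgeSet → ¬ e.IsDiag := G.not_isDiag_of_mem_edgeSet
  simp only [switched, edgeSet_fromEdgeSet, Set.mem_sdiff, Set.mem_union, Set.mem_insert_iff,
    Set.mem_singleton_iff, Sym2.mem_diagSet]
  constructor
  · tauto
  · rintro (h | rfl | rfl)
    · tauto
    · simp [hac]
    · simp [hbd]

/-- The matching number is stable under 2-switch. -/
theorem matchingNumber_stable {V : Type*} [Fintype V]
    (G H : SimpleGraph V) (hsw : TwoSwitch G H) :
    |(matchingNumber H : ℤ) - (matchingNumber G : ℤ)| ≤ 1 := by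
  obtain ⟨a, b, c, d, ⟨-, hac, -, hbc, hbd, -, hGab, -⟩, rfl⟩ := hsw
  have hmem {e : Sym2 V} := mem_edgeSet_switched (G := G) (e := e) hac hbd
  have h₁ : matchingNumber G ≤ matchingNumber (switched G a b c d) + 1 :=
    matchingNumber_le_succ hbc (hmem.2 (Or.inr (Or.inl rfl)))
      fun e he hab hcd => hmem.2 (Or.inl ⟨he, hab, hcd⟩)
  have h₂ : matchingNumber (switched G a b c d) ≤ matchingNumber G + 1 :=
    matchingNumber_le_succ hbc.symm hGab fun e he hne hne' => by
      rcases hmem.1 he with h | h | h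
      · exact h.1
      · exact absurd h hne
      · exact absurd h hne'
  rw [abs_le]
  constructor <;> omega
end

section
/- Let G be a simple graph on a finite vertex set and let τ be a 2-switch on G. Then |α(τ(G)) − α(G)| ≤ 1, where α denotes the independence number. That is, the independence number is stable under 2-switch. -/
open SimpleGraph

variable {V : Type*}

/-- The independence number of `G`: the maximum size of a set of pairwise
non-adjacent vertices of `G`. -/
noncomputable def indepNumber {V : Type*} [Fintype V] (G : SimpleGraph V) : ℕ :=
  sSup {n : ℕ | ∃ s : Set V, s.Pairwise (fun u v => ¬ G.Adj u v) ∧ s.ncard = n}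

theorem bddAbove_ncard_indep {V : Type*} [Fintype V] (G : SimpleGraph V) :
    BddAbove {n : ℕ | ∃ s : Set V, s.Pairwise (fun u v => ¬ G.Adj u v) ∧ s.ncard = n} := by
  refine ⟨Nat.card V, ?_⟩
  rintro n ⟨s, -, rfl⟩
  exact Set.ncard_le_card s

theorem ncard_le_indepNumber {V : Type*} [Fintype V] {G : SimpleGraph V} {s : Set V}
    (hs : s.Pairwise (fun u v => ¬ G.Adj u v)) : s.ncard ≤ indepNumber G :=
  le_csSup (bddAbove_ncard_indep G) ⟨s, hs, rfl⟩

theorem exists_ncard_eq_indepNumber {V : Type*} [Fintype V] (G : SimpleGraph V) :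
    ∃ s : Set V, s.Pairwise (fun u v => ¬ G.Adj u v) ∧ s.ncard = indepNumber G :=
  Nat.sSup_mem (s := {n | ∃ s : Set V, s.Pairwise (fun u v => ¬ G.Adj u v) ∧ s.ncard = n})
    ⟨0, ∅, Set.pairwise_empty _, Set.ncard_empty V⟩ (bddAbove_ncard_indep G)

/-- If `ab` and `cd` are edges of `G`, and every edge of `H` other than `ac` and `bd` is an
edge of `G`, then deleting one vertex from an independent set of `G` makes it independent
in `H`. -/
theorem indepNumber_le_add_one {V : Type*} [Fintype V] {G H : SimpleGraph V} {a b c d : V}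
    (hab : G.Adj a b) (hcd : G.Adj c d)
    (hH : ∀ u v, H.Adj u v → G.Adj u v ∨ s(u, v) = s(a, c) ∨ s(u, v) = s(b, d)) :
    indepNumber G ≤ indepNumber H + 1 := by
  obtain ⟨s, hs, hcard⟩ := exists_ncard_eq_indepNumber G
  obtain ⟨x, hx⟩ : ∃ x, (s \ {x}).Pairwise (fun u v => ¬ H.Adj u v) := by
    have hab' : ¬ (a ∈ s ∧ b ∈ s) := fun h => hs h.1 h.2 hab.ne hab
    have hcd' : ¬ (c ∈ s ∧ d ∈ s) := fun h => hs h.1 h.2 hcd.ne hcd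
    by_cases hac : a ∈ s ∧ c ∈ s
    · refine ⟨a, fun u hu v hv huv h => ?_⟩
      have := hs hu.1 hv.1 huv
      have := hH u v h
      simp only [Sym2.eq_iff, Set.mem_sdiff, Set.mem_singleton_iff] at *
      grind
    · refine ⟨b, fun u hu v hv huv h => ?_⟩
      have := hs hu.1 hv.1 huv
      have := hH u v h
      simp only [Sym2.eq_iff, Set.mem_sdiff, Set.mem_singleton_iff] at *
      grind
  have h₁ := ncard_le_indepNumber hx
  have h₂ := Set.ncard_le_ncard_sdiff_add_ncard s {x}
  rw [Set.ncard_singleton] at h₂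
  omega

/-- The independence number is stable under 2-switch. -/
theorem indepNumber_stable {V : Type*} [Fintype V]
    (G H : SimpleGraph V) (hsw : TwoSwitch G H) :
    |(indepNumber H : ℤ) - (indepNumber G : ℤ)| ≤ 1 := by
  obtain ⟨a, b, c, d, ⟨-, hac, -, -, hbd, -, hab, hcd, -, -⟩, rfl⟩ := hsw
  have h₁ : indepNumber G ≤ indepNumber (switched G a b c d) + 1 := by
    refine indepNumber_le_add_one hab hcd fun u v h => ?_
    simp only [switched, fromEdgeSet_adj, Set.mem_union, Set.mem_sdiff, mem_edgeSet,
      Set.mem_insert_iff, Set.mem_singleton_iff] at h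
    tauto
  have h₂ : indepNumber (switched G a b c d) ≤ indepNumber G + 1 := by
    refine indepNumber_le_add_one (a := a) (b := c) (c := b) (d := d) ?_ ?_ fun u v h => ?_
    · simp [switched, hac]
    · simp [switched, hbd]
    · simp only [switched, fromEdgeSet_adj, Set.mem_union, Set.mem_sdiff, mem_edgeSet,
        Set.mem_insert_iff, Set.mem_singleton_iff]
      have := h.ne
      tauto
  rw [abs_le]
  omega
end

section
/- Let G be a simple graph on a finite vertex set and let τ be a 2-switch on G. Then |γ(τ(G)) − γ(G)| ≤ 1, where γ denotes the domination number. That is, the domination number is stable under 2-switch. -/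
open SimpleGraph

variable {V : Type*}

/-- The domination number of `G`: the minimum size of a set `D` of vertices such that
every vertex not in `D` is adjacent to a vertex of `D`. -/
noncomputable def dominationNumber {V : Type*} [Fintype V] (G : SimpleGraph V) : ℕ :=
  sInf {n : ℕ | ∃ D : Set V, (∀ v : V, v ∉ D → ∃ u ∈ D, G.Adj u v) ∧ D.ncard = n}

/-- If `G` loses at most the edges `ab`, `cd` in passing to `H`, and `ac`, `bd` are edges of `H`,
then the domination number increases by at most one. -/
theorem dominationNumber_le_add_one {V : Type*} [Fintype V] {G H : SimpleGraph V} {a b c d : V}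
    (hGH : ∀ u v, G.Adj u v → H.Adj u v ∨ s(u, v) = s(a, b) ∨ s(u, v) = s(c, d))
    (hac : H.Adj a c) (hbd : H.Adj b d) :
    dominationNumber H ≤ dominationNumber G + 1 := by
  obtain ⟨D, hD, hcard⟩ : dominationNumber G ∈
      {n : ℕ | ∃ D : Set V, (∀ v : V, v ∉ D → ∃ u ∈ D, G.Adj u v) ∧ D.ncard = n} :=
    Nat.sInf_mem ⟨_, Set.univ, fun v hv => absurd (Set.mem_univ v) hv, rfl⟩
  obtain ⟨x, hx⟩ : ∃ x, ∀ v, v ∉ insert x D → ∃ u ∈ insert x D, H.Adj u v := by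
    have key : ∀ x, (∀ v, v ∉ insert x D → v = a ∨ v = b ∨ v = c ∨ v = d →
        ∃ u ∈ insert x D, H.Adj u v) →
        ∀ v, v ∉ insert x D → ∃ u ∈ insert x D, H.Adj u v := by
      intro x hx v hv
      obtain ⟨u, hu, huv⟩ := hD v fun h => hv (Set.mem_insert_of_mem x h)
      rcases hGH u v huv with h | h | h
      · exact ⟨u, Set.mem_insert_of_mem x hu, h⟩
      all_goals
        rw [Sym2.eq_iff] at h
        exact hx v hv (by tauto)
    by_cases ha : a ∈ D
    · exact ⟨b, key b (by grind [H.adj_comm])⟩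
    by_cases hb : b ∈ D
    · exact ⟨a, key a (by grind [H.adj_comm])⟩
    by_cases hc : c ∈ D
    · exact ⟨d, key d (by grind [H.adj_comm])⟩
    by_cases hd : d ∈ D
    · exact ⟨c, key c (by grind [H.adj_comm])⟩
    refine ⟨a, fun v hv => ?_⟩
    obtain ⟨u, hu, huv⟩ := hD v fun h => hv (Set.mem_insert_of_mem a h)
    refine ⟨u, Set.mem_insert_of_mem a hu, (hGH u v huv).resolve_right ?_⟩
    rw [Sym2.eq_iff, Sym2.eq_iff]
    grind
  calc dominationNumber H ≤ (insert x D).ncard := Nat.sInf_le ⟨_, hx, rfl⟩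
    _ ≤ D.ncard + 1 := Set.ncard_insert_le x D
    _ = dominationNumber G + 1 := by rw [hcard]

/-- The domination number is stable under 2-switch. -/
theorem dominationNumber_stable {V : Type*} [Fintype V]
    (G H : SimpleGraph V) (hsw : TwoSwitch G H) :
    |(dominationNumber H : ℤ) - (dominationNumber G : ℤ)| ≤ 1 := by
  obtain ⟨a, b, c, d, ⟨-, hac, -, -, hbd, -, hGab, hGcd, -, -⟩, rfl⟩ := hsw
  have hle : dominationNumber (switched G a b c d) ≤ dominationNumber G + 1 := by
    apply dominationNumber_le_add_one (a := a) (b := b) (c := c) (d := d)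
    · intro u v huv
      have := huv.ne
      simp only [switched, fromEdgeSet_adj, Set.mem_union, Set.mem_sdiff, mem_edgeSet,
        Set.mem_insert_iff, Set.mem_singleton_iff]
      tauto
    · simp [switched, hac]
    · simp [switched, hbd]
  have hge : dominationNumber G ≤ dominationNumber (switched G a b c d) + 1 := by
    apply dominationNumber_le_add_one (a := a) (b := c) (c := b) (d := d) _ hGab hGcd
    intro u v huv
    simp only [switched, fromEdgeSet_adj, Set.mem_union, Set.mem_sdiff, mem_edgeSet,
      Set.mem_insert_iff, Set.mem_singleton_iff] at huv
    tauto
  rw [abs_le]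
  omega
end

section
/- Let G be a simple graph on a finite vertex set and let τ be a 2-switch on G. Then |κ(τ(G)) − κ(G)| ≤ 1, where κ(G) denotes the number of connected components of G. That is, the number of connected components is stable under 2-switch. -/
open SimpleGraph

variable {V : Type*}

lemma reachable_sup_edge_self (G : SimpleGraph V) (u v : V) : (G ⊔ edge u v).Reachable u v := by
  by_cases huv : u = v
  · exact huv ▸ Reachable.refl _
  · exact Adj.reachable (by simp [edge_adj, huv])

lemma reachable_of_reachable_sup_edge {G : SimpleGraph V} {u v x y : V}
    (h : (G ⊔ edge u v).Reachable x y) :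
    G.Reachable x y ∨ (G.Reachable x u ∧ G.Reachable v y) ∨
      (G.Reachable x v ∧ G.Reachable u y) := by
  obtain ⟨p⟩ := h
  induction p with
  | nil => exact Or.inl (Reachable.refl _)
  | @cons x z y hadj _ ih =>
    rw [sup_adj, edge_adj] at hadj
    rcases hadj with hadj | ⟨⟨rfl, rfl⟩ | ⟨rfl, rfl⟩, -⟩
    · exact ih.imp hadj.reachable.trans
        (Or.imp (And.imp_left hadj.reachable.trans) (And.imp_left hadj.reachable.trans))
    · rcases ih with h | ⟨-, h⟩ | ⟨-, h⟩
      · exact Or.inr (Or.inl ⟨Reachable.refl _, h⟩)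
      · exact Or.inr (Or.inl ⟨Reachable.refl _, h⟩)
      · exact Or.inl h
    · rcases ih with h | ⟨-, h⟩ | ⟨-, h⟩
      · exact Or.inr (Or.inr ⟨Reachable.refl _, h⟩)
      · exact Or.inl h
      · exact Or.inr (Or.inr ⟨Reachable.refl _, h⟩)

lemma kappa_le_of_le [Finite V] {G H : SimpleGraph V} (h : G ≤ H) : kappa H ≤ kappa G :=
  ConnectedComponent.card_le_card_of_le h

lemma kappa_le_kappa_sup_edge_add_one [Finite V] (G : SimpleGraph V) (u v : V) :
    kappa G ≤ kappa (G ⊔ edge u v) + 1 := by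
  classical
  let f : G.ConnectedComponent → Option (G ⊔ edge u v).ConnectedComponent := fun C =>
    if C = G.connectedComponentMk v then none
    else some (C.map (Hom.ofLE (le_sup_left : G ≤ G ⊔ edge u v)))
  have hf : Function.Injective f := by
    intro C D
    induction C using ConnectedComponent.ind with | _ x
    induction D using ConnectedComponent.ind with | _ y
    intro hCD
    by_cases hx : G.connectedComponentMk x = G.connectedComponentMk v
    · by_cases hy : G.connectedComponentMk y = G.connectedComponentMk v
      · exact hx.trans hy.symm
      · simp [f, hx, hy] at hCD
    · by_cases hy : G.connectedComponentMk y = G.connectedComponentMk v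
      · simp [f, hx, hy] at hCD
      · simp only [f, if_neg hx, if_neg hy, Option.some.injEq, ConnectedComponent.map_mk,
          ConnectedComponent.eq] at hCD
        rw [ConnectedComponent.eq] at hx hy ⊢
        rcases reachable_of_reachable_sup_edge hCD with h | ⟨-, h⟩ | ⟨h, -⟩
        · exact h
        · exact absurd h.symm hy
        · exact absurd h hx
  have := Nat.card_le_card_of_injective f hf
  rwa [Finite.card_option] at this

lemma kappa_sup_edge_lt [Finite V] {G : SimpleGraph V} {u v : V} (h : ¬ G.Reachable u v) :
    kappa (G ⊔ edge u v) < kappa G := by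
  contrapose! h
  have hbij := (ConnectedComponent.surjective_map_ofLE
    (le_sup_left : G ≤ G ⊔ edge u v)).bijective_of_nat_card_le h
  rw [← ConnectedComponent.eq]
  exact hbij.injective (ConnectedComponent.sound (reachable_sup_edge_self G u v))

lemma kappa_sup_edge_of_reachable {G : SimpleGraph V} {u v : V} (h : G.Reachable u v) :
    kappa (G ⊔ edge u v) = kappa G := by
  have hiff : (G ⊔ edge u v).Reachable = G.Reachable := by
    ext x y
    refine ⟨fun hxy => ?_, fun hxy => hxy.mono le_sup_left⟩
    rcases reachable_of_reachable_sup_edge hxy with h' | ⟨h₁, h₂⟩ | ⟨h₁, h₂⟩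
    · exact h'
    · exact h₁.trans (h.trans h₂)
    · exact h₁.trans (h.symm.trans h₂)
  unfold kappa ConnectedComponent
  rw [hiff]

lemma kappa_sup_edges_le [Finite V] (F : SimpleGraph V) (a b c d : V) :
    kappa (F ⊔ edge a c ⊔ edge b d) ≤ kappa (F ⊔ edge a b ⊔ edge c d) + 1 := by
  have hab := kappa_le_kappa_sup_edge_add_one F a b
  have hcd := kappa_le_kappa_sup_edge_add_one (F ⊔ edge a b) c d
  by_cases hac : F.Reachable a c
  · by_cases hbd : F.Reachable b d
    · have h : (F ⊔ edge a b).Reachable c d :=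
        (hac.symm.mono le_sup_left).trans
          ((reachable_sup_edge_self F a b).trans (hbd.mono le_sup_left))
      have hle : kappa (F ⊔ edge a c ⊔ edge b d) ≤ kappa F :=
        kappa_le_of_le (le_sup_left.trans le_sup_left)
      rw [kappa_sup_edge_of_reachable h]
      omega
    · have hlt := kappa_sup_edge_lt hbd
      have hle : kappa (F ⊔ edge a c ⊔ edge b d) ≤ kappa (F ⊔ edge b d) :=
        kappa_le_of_le (sup_le_sup_right le_sup_left _)
      omega
  · have hlt := kappa_sup_edge_lt hac
    have hle : kappa (F ⊔ edge a c ⊔ edge b d) ≤ kappa (F ⊔ edge a c) :=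
      kappa_le_of_le le_sup_left
    omega

lemma deleteEdges_sup_edges {G : SimpleGraph V} {a b c d : V} (hab : G.Adj a b) (hcd : G.Adj c d) :
    G.deleteEdges {s(a, b), s(c, d)} ⊔ edge a b ⊔ edge c d = G := by
  ext x y
  have := hab.symm
  have := hcd.symm
  simp only [sup_adj, deleteEdges_adj, edge_adj, Set.mem_insert_iff, Set.mem_singleton_iff,
    Sym2.eq_iff]
  grind [G.ne_of_adj]

lemma switched_eq_sup_edges (G : SimpleGraph V) (a b c d : V) :
    switched G a b c d = G.deleteEdges {s(a, b), s(c, d)} ⊔ edge a c ⊔ edge b d := by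
  ext x y
  simp only [switched, fromEdgeSet_adj, sup_adj, deleteEdges_adj, edge_adj, Set.mem_union,
    Set.mem_sdiff, mem_edgeSet, Set.mem_insert_iff, Set.mem_singleton_iff, Sym2.eq_iff]
  grind [G.ne_of_adj]

/-- The number of connected components is stable under 2-switch. -/
theorem numComponents_stable {V : Type*} [Fintype V]
    (G H : SimpleGraph V) (hsw : TwoSwitch G H) :
    |(kappa H : ℤ) - (kappa G : ℤ)| ≤ 1 := by
  obtain ⟨a, b, c, d, ⟨-, -, -, -, -, -, hab, hcd, -, -⟩, rfl⟩ := hsw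
  have h₁ := kappa_sup_edges_le (G.deleteEdges {s(a, b), s(c, d)}) a b c d
  have h₂ := kappa_sup_edges_le (G.deleteEdges {s(a, b), s(c, d)}) a c b d
  rw [← switched_eq_sup_edges, deleteEdges_sup_edges hab hcd] at h₁ h₂
  rw [abs_le]
  omega
end

section
/- Let G be a simple graph on a finite vertex set and let τ be a 2-switch on G. Then |π(τ(G)) − π(G)| ≤ 1, where π denotes the path-covering number. That is, the path-covering number is stable under 2-switch. -/
open SimpleGraph

variable {V : Type*}

/-- `G` admits a covering of its vertex set by `k` pairwise vertex-disjoint paths. -/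
def HasPathCover (G : SimpleGraph V) (k : ℕ) : Prop :=
  ∃ P : Fin k → (u : V) × (v : V) × G.Walk u v,
    (∀ i, (P i).2.2.IsPath) ∧
    (∀ i j, i ≠ j → ∀ x : V, x ∈ (P i).2.2.support → x ∉ (P j).2.2.support) ∧
    (∀ x : V, ∃ i, x ∈ (P i).2.2.support)

/-- The path-covering number of `G`: the minimum number of pairwise vertex-disjoint
paths of `G` needed to cover all vertices of `G`. -/
noncomputable def pathCoverNumber {V : Type*} [Fintype V] (G : SimpleGraph V) : ℕ :=
  sInf {k : ℕ | HasPathCover G k}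

/-- The number of consecutive pairs of entries of a list which are not adjacent in `G`. -/
noncomputable def breakCount (G : SimpleGraph V) : List V → ℕ
  | [] => 0
  | [_] => 0
  | x :: y :: t => (open Classical in if G.Adj x y then 0 else 1) + breakCount G (y :: t)

theorem breakCount_append (G : SimpleGraph V) (X Y : List V) (p q : V) :
    breakCount G (X ++ p :: q :: Y) =
      breakCount G (X ++ [p]) + breakCount G [p, q] + breakCount G (q :: Y) := by
  induction X with
  | nil => simp [breakCount]
  | cons x X ih =>
    cases X with
    | nil => simp [breakCount]; ring
    | cons y X =>
      simp only [List.cons_append, breakCount] at ih ⊢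
      rw [ih]; ring

theorem breakCount_pair_le (G : SimpleGraph V) (p q : V) : breakCount G [p, q] ≤ 1 := by
  simp only [breakCount]; split_ifs <;> simp

theorem breakCount_pair_of_adj {G : SimpleGraph V} {p q : V} (h : G.Adj p q) :
    breakCount G [p, q] = 0 := by
  simp [breakCount, h]

theorem breakCount_append_le (G : SimpleGraph V) (X Y : List V) :
    breakCount G (X ++ Y) ≤ breakCount G X + breakCount G Y + 1 := by
  rcases List.eq_nil_or_concat' X with rfl | ⟨X, p, rfl⟩
  · simp only [List.nil_append]; omega
  · cases Y with
    | nil => simp only [List.append_nil]; omega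
    | cons q Y =>
      have h := breakCount_append G X Y p q
      have := breakCount_pair_le G p q
      simp only [List.append_assoc, List.singleton_append] at h ⊢
      omega

theorem breakCount_reverse (G : SimpleGraph V) (l : List V) :
    breakCount G l.reverse = breakCount G l := by
  induction l with
  | nil => rfl
  | cons x l ih =>
    cases l with
    | nil => rfl
    | cons y t =>
      have h := breakCount_append G t.reverse [] y x
      simp only [List.reverse_cons, List.append_assoc, List.cons_append, List.nil_append] at ih ⊢
      rw [h, ih]
      by_cases hxy : G.Adj x y
      · simp [breakCount, hxy, hxy.symm]
      · simp [breakCount, hxy, mt SimpleGraph.Adj.symm hxy]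
        ring

theorem breakCount_le_of_infix {G H : SimpleGraph V} {l : List V}
    (h : ∀ x y, [x, y] <:+: l → G.Adj x y → H.Adj x y) : breakCount H l ≤ breakCount G l := by
  induction l with
  | nil => simp [breakCount]
  | cons x l ih =>
    cases l with
    | nil => simp [breakCount]
    | cons y t =>
      have h1 := ih fun u v huv => h u v (huv.trans (List.suffix_cons x _).isInfix)
      have h2 := h x y ⟨[], t, rfl⟩
      simp only [breakCount]
      split_ifs <;> first | omega | tauto

theorem breakCount_le_of_mem {G H : SimpleGraph V} {l : List V}
    (h : ∀ x ∈ l, ∀ y ∈ l, G.Adj x y → H.Adj x y) : breakCount H l ≤ breakCount G l :=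
  breakCount_le_of_infix fun x y hxy =>
    h x (hxy.subset (by simp)) y (hxy.subset (by simp))

theorem SimpleGraph.Walk.breakCount_support {G : SimpleGraph V} {u v : V} (w : G.Walk u v) :
    breakCount G w.support = 0 := by
  induction w with
  | nil => rfl
  | cons h w ih =>
    rw [← Walk.cons_tail_support w] at ih
    rw [Walk.support_cons, ← Walk.cons_tail_support w, breakCount, ih, if_pos h]

theorem breakCount_flatten_lt {G : SimpleGraph V} {L : List (List V)} (hL : L ≠ [])
    (h : ∀ l ∈ L, breakCount G l = 0) : breakCount G L.flatten < L.length := by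
  induction L with
  | nil => exact absurd rfl hL
  | cons l L ih =>
    have hl := h l (by simp)
    by_cases hn : L = []
    · subst hn; simp [hl]
    · have h1 := ih hn fun m hm => h m (by simp [hm])
      have h2 := breakCount_append_le G l L.flatten
      simp only [List.flatten_cons, List.length_cons]
      omega

theorem HasPathCover.exists_list [Nonempty V] {G : SimpleGraph V} {k : ℕ}
    (h : HasPathCover G k) :
    ∃ l : List V, l.Nodup ∧ (∀ x, x ∈ l) ∧ breakCount G l < k := by
  obtain ⟨P, hP, hd, hc⟩ := h
  refine ⟨(List.ofFn fun i => (P i).2.2.support).flatten, ?_, ?_, ?_⟩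
  · rw [List.nodup_flatten]
    constructor
    · intro l hl
      obtain ⟨i, rfl⟩ := (List.mem_ofFn' _ _).1 hl
      exact (hP i).support_nodup
    · rw [List.pairwise_ofFn]
      intro i j hij x hx hx'
      exact hd i j hij.ne x hx hx'
  · intro x
    obtain ⟨i, hi⟩ := hc x
    exact List.mem_flatten.2 ⟨_, (List.mem_ofFn' _ _).2 ⟨i, rfl⟩, hi⟩
  · have h := breakCount_flatten_lt (G := G) (L := List.ofFn fun i => (P i).2.2.support) ?_ ?_
    · simpa using h
    · obtain ⟨i, -⟩ := hc (Classical.arbitrary V)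
      exact List.ne_nil_of_mem ((List.mem_ofFn' _ _).2 ⟨i, rfl⟩)
    · intro l hl
      obtain ⟨i, rfl⟩ := (List.mem_ofFn' _ _).1 hl
      exact (P i).2.2.breakCount_support

theorem exists_walks_of_list (G : SimpleGraph V) (x : V) (l : List V) :
    ∃ L : List ((u : V) × (v : V) × G.Walk u v),
      L.flatMap (fun w => w.2.2.support) = x :: l ∧ L.length = breakCount G (x :: l) + 1 := by
  induction l generalizing x with
  | nil => exact ⟨[⟨x, x, Walk.nil⟩], by simp, by simp [breakCount]⟩
  | cons y t ih =>
    obtain ⟨L, hL, hlen⟩ := ih y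
    by_cases hxy : G.Adj x y
    · cases L with
      | nil => simp at hL
      | cons w L =>
        obtain ⟨u, v, w⟩ := w
        obtain rfl : u = y := by
          rw [List.flatMap_cons, ← Walk.cons_tail_support w] at hL
          exact (List.cons.inj hL).1
        refine ⟨⟨x, v, Walk.cons hxy w⟩ :: L, ?_, ?_⟩
        · simpa using hL
        · simpa [breakCount, hxy] using hlen
    · refine ⟨⟨x, x, Walk.nil⟩ :: L, ?_, ?_⟩
      · simpa using hL
      · simp [breakCount, hxy, hlen]; ring

theorem hasPathCover_of_list [Nonempty V] {G : SimpleGraph V} {l : List V} (hl : l.Nodup)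
    (hc : ∀ x, x ∈ l) : HasPathCover G (breakCount G l + 1) := by
  cases l with
  | nil => exact absurd (hc (Classical.arbitrary V)) (by simp)
  | cons x l =>
    obtain ⟨L, hL, hlen⟩ := exists_walks_of_list G x l
    rw [← hL, List.nodup_flatMap] at hl
    obtain ⟨hn, hd⟩ := hl
    rw [← hlen]
    refine ⟨L.get, fun i => ?_, fun i j hij y hi hj => ?_, fun y => ?_⟩
    · exact (Walk.isPath_def _).2 (hn _ (List.get_mem _ _))
    · rw [List.pairwise_iff_get] at hd
      rcases lt_or_gt_of_ne hij with h | h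
      · exact hd i j h hi hj
      · exact hd j i h hj hi
    · have hy := hc y
      rw [← hL, List.mem_flatMap] at hy
      obtain ⟨w, hw, hy⟩ := hy
      obtain ⟨i, rfl⟩ := List.get_of_mem hw
      exact ⟨i, hy⟩

/-- The edges of `G` other than `ab` and `cd` are edges of `H`, and so are `ac` and `bd`. -/
def SwitchLE (G H : SimpleGraph V) (a b c d : V) : Prop :=
  (∀ x y, G.Adj x y → s(x, y) ≠ s(a, b) → s(x, y) ≠ s(c, d) → H.Adj x y) ∧
    H.Adj a c ∧ H.Adj b d

namespace SwitchLE

variable {G H : SimpleGraph V} {a b c d : V}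

theorem swap (h : SwitchLE G H a b c d) : SwitchLE G H b a d c :=
  ⟨fun x y hxy h1 h2 => h.1 x y hxy (by rwa [Sym2.eq_swap (a := a)]) (by rwa [Sym2.eq_swap (a := c)]), h.2.2, h.2.1⟩

theorem exchange (h : SwitchLE G H a b c d) : SwitchLE G H c d a b :=
  ⟨fun x y hxy h1 h2 => h.1 x y hxy h2 h1, h.2.1.symm, h.2.2.symm⟩

theorem breakCount_le (h : SwitchLE G H a b c d) {l : List V} (hab : a ∉ l ∨ b ∉ l)
    (hcd : c ∉ l ∨ d ∉ l) : breakCount H l ≤ breakCount G l := by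
  refine breakCount_le_of_mem fun x hx y hy hxy => h.1 x y hxy ?_ ?_ <;>
  · rw [Ne, Sym2.eq_iff]
    rintro (⟨rfl, rfl⟩ | ⟨rfl, rfl⟩) <;> tauto

theorem exists_perm_of_parallel (h : SwitchLE G H a b c d) {X Y Z : List V}
    (hl : (X ++ a :: b :: (Y ++ c :: d :: Z)).Nodup) :
    ∃ l', l'.Perm (X ++ a :: b :: (Y ++ c :: d :: Z)) ∧
      breakCount H l' ≤ breakCount G (X ++ a :: b :: (Y ++ c :: d :: Z)) + 1 := by
  refine ⟨X ++ a :: c :: (Y.reverse ++ b :: d :: Z), ?_, ?_⟩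
  · classical
    rw [List.perm_iff_count]
    intro x
    simp only [List.count_append, List.count_cons, List.count_reverse]
    ring
  · have e1 := breakCount_append H X (Y.reverse ++ b :: d :: Z) a c
    have e2 := breakCount_append H (c :: Y.reverse) Z b d
    have e3 := breakCount_append G X (Y ++ c :: d :: Z) a b
    have e4 := breakCount_append G (b :: Y) Z c d
    have e5 := breakCount_reverse H (b :: Y ++ [c])
    simp only [List.reverse_append, List.reverse_cons, List.reverse_nil, List.nil_append,
      List.cons_append] at e1 e2 e3 e4 e5
    have h1 := breakCount_pair_of_adj h.2.1
    have h2 := breakCount_pair_of_adj h.2.2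
    have h3 : breakCount H (X ++ [a]) ≤ breakCount G (X ++ [a]) :=
      h.breakCount_le (by grind) (by grind)
    have h4 : breakCount H (b :: (Y ++ [c])) ≤ breakCount G (b :: (Y ++ [c])) :=
      h.breakCount_le (by grind) (by grind)
    have h5 : breakCount H (d :: Z) ≤ breakCount G (d :: Z) :=
      h.breakCount_le (by grind) (by grind)
    omega

theorem exists_perm_of_crossed (h : SwitchLE G H a b c d) {X Y Z : List V}
    (hl : (X ++ a :: b :: (Y ++ d :: c :: Z)).Nodup) :
    ∃ l', l'.Perm (X ++ a :: b :: (Y ++ d :: c :: Z)) ∧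
      breakCount H l' ≤ breakCount G (X ++ a :: b :: (Y ++ d :: c :: Z)) + 1 := by
  refine ⟨(X ++ a :: c :: Z) ++ (b :: (Y ++ [d])), ?_, ?_⟩
  · classical
    rw [List.perm_iff_count]
    intro x
    simp only [List.count_append, List.count_cons, List.count_nil]
    ring
  · have e1 := breakCount_append H X Z a c
    have e2 := breakCount_append_le H (X ++ a :: c :: Z) (b :: (Y ++ [d]))
    have e3 := breakCount_append G X (Y ++ d :: c :: Z) a b
    have e4 := breakCount_append G (b :: Y) Z d c
    simp only [List.cons_append] at e4
    have h1 := breakCount_pair_of_adj h.2.1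
    have h3 : breakCount H (X ++ [a]) ≤ breakCount G (X ++ [a]) :=
      h.breakCount_le (by grind) (by grind)
    have h4 : breakCount H (b :: (Y ++ [d])) ≤ breakCount G (b :: (Y ++ [d])) :=
      h.breakCount_le (by grind) (by grind)
    have h5 : breakCount H (c :: Z) ≤ breakCount G (c :: Z) :=
      h.breakCount_le (by grind) (by grind)
    omega

theorem breakCount_le_add_one (h : SwitchLE G H a b c d) {l : List V} (hl : l.Nodup)
    (hc : ¬ [c, d] <:+: l) (hd : ¬ [d, c] <:+: l) :
    breakCount H l ≤ breakCount G l + 1 := by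
  have key : ∀ m : List V, m <:+: l → ¬ [a, b] <:+: m → ¬ [b, a] <:+: m →
      breakCount H m ≤ breakCount G m := by
    intro m hm h1 h2
    refine breakCount_le_of_infix fun x y hi hxy => h.1 x y hxy ?_ ?_ <;>
    · rw [Ne, Sym2.eq_iff]
      rintro (⟨rfl, rfl⟩ | ⟨rfl, rfl⟩) <;>
        first
        | exact h1 hi
        | exact h2 hi
        | exact hc (hi.trans hm)
        | exact hd (hi.trans hm)
  by_cases hab : ∃ p q, s(p, q) = s(a, b) ∧ [p, q] <:+: l
  · obtain ⟨p, q, hpq, X, Y, rfl⟩ := hab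
    have e : X ++ [p, q] ++ Y = X ++ p :: q :: Y := by simp
    rw [e] at hl key ⊢
    have not_infix : ∀ m : List V, (p ∉ m ∨ q ∉ m) → ¬ [a, b] <:+: m ∧ ¬ [b, a] <:+: m := by
      intro m hm
      have hm' : a ∉ m ∨ b ∉ m := by
        rcases Sym2.eq_iff.1 hpq with ⟨rfl, rfl⟩ | ⟨rfl, rfl⟩ <;> tauto
      exact ⟨fun hi => hm'.elim (· (hi.subset (by simp))) (· (hi.subset (by simp))),
        fun hi => hm'.elim (· (hi.subset (by simp))) (· (hi.subset (by simp)))⟩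
    have n1 := not_infix (X ++ [p]) (by grind)
    have n2 := not_infix (q :: Y) (by grind)
    have h1 := key (X ++ [p]) ⟨[], q :: Y, by simp⟩ n1.1 n1.2
    have h2 := key (q :: Y) ⟨X ++ [p], [], by simp⟩ n2.1 n2.2
    have h3 := breakCount_pair_le H p q
    rw [breakCount_append H, breakCount_append G]
    omega
  · push Not at hab
    have := key l List.infix_rfl (hab a b rfl) (hab b a Sym2.eq_swap)
    omega

end SwitchLE

theorem List.Nodup.exists_eq_append_of_infix {l : List V} (hl : l.Nodup) {p q r s : V}
    (hpq : [p, q] <:+: l) (hrs : [r, s] <:+: l) (hpr : p ≠ r) (hps : p ≠ s) (hqr : q ≠ r) :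
    (∃ X Y Z, l = X ++ p :: q :: (Y ++ r :: s :: Z)) ∨
      ∃ X Y Z, l = X ++ r :: s :: (Y ++ p :: q :: Z) := by
  obtain ⟨A, B, rfl⟩ := hpq
  obtain ⟨C, D, h⟩ := hrs
  simp only [List.append_assoc, List.cons_append, List.nil_append] at h hl ⊢
  rcases List.append_eq_append_iff.1 h with ⟨E, h1, h2⟩ | ⟨E, h1, h2⟩
  · rcases E with _ | ⟨e, _ | ⟨f, E⟩⟩
    · simp at h2; grind
    · simp at h2; grind
    · simp only [List.cons_append, List.cons.injEq] at h2
      obtain ⟨rfl, rfl, rfl⟩ := h2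
      exact Or.inr ⟨C, E, B, by simp [h1]⟩
  · rcases E with _ | ⟨e, _ | ⟨f, E⟩⟩
    · simp at h2; grind
    · simp at h2; grind
    · simp only [List.cons_append, List.cons.injEq] at h2
      obtain ⟨rfl, rfl, rfl⟩ := h2
      exact Or.inl ⟨A, E, D, by simp⟩

theorem SwitchLE.exists_perm {G H : SimpleGraph V} {a b c d : V} (h : SwitchLE G H a b c d)
    (hac : a ≠ c) (had : a ≠ d) (hbc : b ≠ c) (hbd : b ≠ d) {l : List V} (hl : l.Nodup) :
    ∃ l', l'.Perm l ∧ breakCount H l' ≤ breakCount G l + 1 := by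
  by_cases hcd : [c, d] <:+: l ∨ [d, c] <:+: l
  · by_cases hab : [a, b] <:+: l ∨ [b, a] <:+: l
    · rcases hab with hab | hab <;> rcases hcd with hcd | hcd
      · rcases hl.exists_eq_append_of_infix hab hcd hac had hbc with
          ⟨X, Y, Z, rfl⟩ | ⟨X, Y, Z, rfl⟩
        · exact h.exists_perm_of_parallel hl
        · exact h.exchange.exists_perm_of_parallel hl
      · rcases hl.exists_eq_append_of_infix hab hcd had hac hbd with
          ⟨X, Y, Z, rfl⟩ | ⟨X, Y, Z, rfl⟩
        · exact h.exists_perm_of_crossed hl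
        · exact h.exchange.swap.exists_perm_of_crossed hl
      · rcases hl.exists_eq_append_of_infix hab hcd hbc hbd hac with
          ⟨X, Y, Z, rfl⟩ | ⟨X, Y, Z, rfl⟩
        · exact h.swap.exists_perm_of_crossed hl
        · exact h.exchange.exists_perm_of_crossed hl
      · rcases hl.exists_eq_append_of_infix hab hcd hbd hbc had with
          ⟨X, Y, Z, rfl⟩ | ⟨X, Y, Z, rfl⟩
        · exact h.swap.exists_perm_of_parallel hl
        · exact h.exchange.swap.exists_perm_of_parallel hl
    · push Not at hab
      exact ⟨l, List.Perm.refl l, h.exchange.breakCount_le_add_one hl hab.1 hab.2⟩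
  · push Not at hcd
    exact ⟨l, List.Perm.refl l, h.breakCount_le_add_one hl hcd.1 hcd.2⟩

theorem SwitchLE.pathCoverNumber_le {V : Type*} [Fintype V] {G H : SimpleGraph V} {a b c d : V}
    (h : SwitchLE G H a b c d) (hac : a ≠ c) (had : a ≠ d) (hbc : b ≠ c) (hbd : b ≠ d) :
    pathCoverNumber H ≤ pathCoverNumber G + 1 := by
  have : Nonempty V := ⟨a⟩
  have hne : {k : ℕ | HasPathCover G k}.Nonempty :=
    ⟨_, hasPathCover_of_list Finset.univ.nodup_toList (by simp)⟩
  obtain ⟨l, hl, hmem, hlt⟩ := HasPathCover.exists_list (Nat.sInf_mem hne)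
  obtain ⟨l', hp, hle⟩ := h.exists_perm hac had hbc hbd hl
  have h1 : pathCoverNumber H ≤ breakCount H l' + 1 :=
    Nat.sInf_le (hasPathCover_of_list (hp.nodup_iff.2 hl) fun x => hp.mem_iff.2 (hmem x))
  have h2 : breakCount G l < pathCoverNumber G := hlt
  omega

theorem IsSwitchPair.switchLE {G : SimpleGraph V} {a b c d : V} (h : IsSwitchPair G a b c d) :
    SwitchLE G (switched G a b c d) a b c d := by
  obtain ⟨-, hac, -, -, hbd, -⟩ := h
  refine ⟨fun x y hxy h1 h2 => ?_, ?_, ?_⟩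
  · simp only [switched, fromEdgeSet_adj]
    exact ⟨Or.inl ⟨hxy, by simp [-Sym2.eq, h1, h2]⟩, hxy.ne⟩
  · simp [switched, hac]
  · simp [switched, hbd]

theorem IsSwitchPair.switchLE_symm {G : SimpleGraph V} {a b c d : V}
    (h : IsSwitchPair G a b c d) : SwitchLE (switched G a b c d) G a c b d := by
  obtain ⟨-, -, -, -, -, -, hab, hcd, -, -⟩ := h
  refine ⟨fun x y hxy h1 h2 => ?_, hab, hcd⟩
  simp only [switched, fromEdgeSet_adj] at hxy
  rcases hxy.1 with h | h | h
  · exact h.1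
  · exact absurd h h1
  · exact absurd h h2

/-- The path-covering number is stable under 2-switch. -/
theorem pathCoverNumber_stable {V : Type*} [Fintype V]
    (G H : SimpleGraph V) (hsw : TwoSwitch G H) :
    |(pathCoverNumber H : ℤ) - (pathCoverNumber G : ℤ)| ≤ 1 := by
  obtain ⟨a, b, c, d, h, rfl⟩ := hsw
  have h1 := h.switchLE
  have h2 := h.switchLE_symm
  obtain ⟨hab, hac, had, hbc, hbd, hcd, -⟩ := h
  have h3 := h1.pathCoverNumber_le hac had hbc hbd
  have h4 := h2.pathCoverNumber_le hab had hbc.symm hcd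
  rw [abs_le]
  omega
end

section
/- Let G be a simple graph on a finite vertex set and let τ be a 2-switch on G. Then |χ(τ(G)) − χ(G)| ≤ 1, where χ denotes the chromatic number. That is, the chromatic number is stable under 2-switch. -/
open SimpleGraph

variable {V : Type*}

/-- If every edge of `H` outside `G` meets an `H`-independent set `S`, then a coloring of `G`
yields a coloring of `H` with one extra color, used on `S`. -/
theorem chromaticNumber_le_add_one_of_isIndepSet {V : Type*} {G H : SimpleGraph V} {S : Set V}
    (hS : H.IsIndepSet S) (h : ∀ u v, H.Adj u v → u ∉ S → v ∉ S → G.Adj u v) :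
    H.chromaticNumber ≤ G.chromaticNumber + 1 := by
  classical
  by_cases htop : G.chromaticNumber = ⊤
  · simp [htop]
  obtain ⟨n, hn⟩ := ENat.ne_top_iff_exists.mp htop
  obtain ⟨C⟩ := chromaticNumber_le_iff_colorable.mp hn.ge
  let D : H.Coloring (Option (Fin n)) :=
    Coloring.mk (fun v => if v ∈ S then none else some (C v)) fun {u v} huv => by
      by_cases hu : u ∈ S <;> by_cases hv : v ∈ S
      · exact absurd huv (hS hu hv huv.ne)
      · simp [hu, hv]
      · simp [hu, hv]
      · simpa [hu, hv] using C.valid (h u v huv hu hv)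
  rw [← hn]
  simpa using D.colorable.chromaticNumber_le

theorem isIndepSet_pair {V : Type*} {G : SimpleGraph V} {a b : V} (h : ¬ G.Adj a b) :
    G.IsIndepSet {a, b} := by
  rintro u (rfl | rfl) v (rfl | rfl) huv
  exacts [G.loopless.irrefl _, h, fun hba => h hba.symm, G.loopless.irrefl _]

/-- The chromatic number is stable under 2-switch, i.e., the chromatic
numbers of `G` and `τ(G)` differ by at most one. -/
theorem chromaticNumber_stable {V : Type*} [Fintype V]
    (G H : SimpleGraph V) (hsw : TwoSwitch G H) :
    H.chromaticNumber ≤ G.chromaticNumber + 1 ∧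
      G.chromaticNumber ≤ H.chromaticNumber + 1 := by
  obtain ⟨a, b, c, d, ⟨-, -, had, hbc, -, -, -, -, hac, -⟩, rfl⟩ := hsw
  constructor
  · refine chromaticNumber_le_add_one_of_isIndepSet (S := {a, b}) (isIndepSet_pair ?_) ?_
    · simp only [switched, fromEdgeSet_adj, Set.mem_union, Set.mem_sdiff, Set.mem_insert_iff,
        Set.mem_singleton_iff, mem_edgeSet, Sym2.eq_iff]
      grind
    · intro u v huv hu hv
      simp only [switched, fromEdgeSet_adj, Set.mem_union, Set.mem_sdiff, Set.mem_insert_iff,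
        Set.mem_singleton_iff, mem_edgeSet, Sym2.eq_iff] at huv hu hv
      tauto
  · refine chromaticNumber_le_add_one_of_isIndepSet (S := {a, c}) (isIndepSet_pair hac) ?_
    intro u v huv hu hv
    have hne := huv.ne
    simp only [switched, fromEdgeSet_adj, Set.mem_union, Set.mem_sdiff, Set.mem_insert_iff,
      Set.mem_singleton_iff, mem_edgeSet, Sym2.eq_iff] at hu hv ⊢
    tauto
end

section
/- Let G be a simple graph on a finite vertex set with no isolated vertices and let τ be a 2-switch on G such that τ(G) also has no isolated vertices. Then |ε(τ(G)) − ε(G)| ≤ 1, where ε denotes the edge-covering number. That is, the edge-covering number is stable under 2-switch. -/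
open SimpleGraph

variable {V : Type*}

/-- The edge-covering number of `G`: the minimum size of a set of edges of `G` such
that every vertex is incident to at least one edge of the set. -/
noncomputable def edgeCoverNumber {V : Type*} [Fintype V] (G : SimpleGraph V) : ℕ :=
  sInf {n : ℕ | ∃ s : Set (Sym2 V), s ⊆ G.edgeSet ∧ (∀ v : V, ∃ e ∈ s, v ∈ e) ∧
    s.ncard = n}

/-- Trading the edges `ab`, `cd` for `ac`, `bd` raises the edge-covering number by at most one. -/
theorem edgeCoverNumber_le_succ_of_exchange {V : Type*} [Fintype V] {G H : SimpleGraph V}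
    {a b c d : V} (hG : ∀ v : V, ∃ u : V, G.Adj v u)
    (hsub : G.edgeSet \ {s(a, b), s(c, d)} ⊆ H.edgeSet) (hac : H.Adj a c) (hbd : H.Adj b d) :
    edgeCoverNumber H ≤ edgeCoverNumber G + 1 := by
  have hne : {n : ℕ | ∃ s : Set (Sym2 V), s ⊆ G.edgeSet ∧ (∀ v : V, ∃ e ∈ s, v ∈ e) ∧
      s.ncard = n}.Nonempty := by
    refine ⟨_, G.edgeSet, subset_rfl, fun v => ?_, rfl⟩
    obtain ⟨u, hu⟩ := hG v
    exact ⟨s(v, u), hu, Sym2.mem_mk_left v u⟩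
  obtain ⟨S, hS, hcov, hcard⟩ := Nat.sInf_mem hne
  change S.ncard = edgeCoverNumber G at hcard
  have hle : ∀ T : Set (Sym2 V), T ⊆ H.edgeSet → (∀ v : V, ∃ e ∈ T, v ∈ e) →
      edgeCoverNumber H ≤ T.ncard := fun T h₁ h₂ => Nat.sInf_le ⟨T, h₁, h₂, rfl⟩
  rw [← hcard]
  by_cases hmeet : ∃ e ∈ S, e ∈ ({s(a, b), s(c, d)} : Set (Sym2 V))
  · obtain ⟨e, heS, he⟩ := hmeet
    refine (hle (S \ {s(a, b), s(c, d)} ∪ {s(a, c), s(b, d)}) ?_ fun v => ?_).trans ?_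
    · rintro f (hf | rfl | rfl)
      · exact hsub ⟨hS hf.1, hf.2⟩
      · exact hac
      · exact hbd
    · obtain ⟨f, hfS, hvf⟩ := hcov v
      by_cases hf : f ∈ ({s(a, b), s(c, d)} : Set (Sym2 V))
      · have hv : v ∈ s(a, c) ∨ v ∈ s(b, d) := by
          rcases hf with rfl | rfl <;> rcases Sym2.mem_iff.1 hvf with rfl | rfl <;> simp
        rcases hv with hv | hv
        · exact ⟨_, Or.inr (Or.inl rfl), hv⟩
        · exact ⟨_, Or.inr (Or.inr rfl), hv⟩
      · exact ⟨f, Or.inl ⟨hfS, hf⟩, hvf⟩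
    · have h₁ : (S \ {s(a, b), s(c, d)}).ncard < S.ncard :=
        Set.ncard_lt_ncard ⟨Set.sdiff_subset, fun h => (h heS).2 he⟩ S.toFinite
      have h₂ := Set.ncard_union_le (S \ {s(a, b), s(c, d)}) {s(a, c), s(b, d)}
      have h₃ := Set.ncard_insert_le s(a, c) {s(b, d)}
      rw [Set.ncard_singleton] at h₃
      omega
  · push Not at hmeet
    exact (hle S (fun e he => hsub ⟨hS he, hmeet e he⟩) hcov).trans (Nat.le_succ _)

/-- For graphs without isolated vertices, the edge-covering number is
stable under 2-switch. -/
theorem edgeCoverNumber_stable {V : Type*} [Fintype V]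
    (G H : SimpleGraph V) (hsw : TwoSwitch G H)
    (hG : ∀ v : V, ∃ u : V, G.Adj v u) (hH : ∀ v : V, ∃ u : V, H.Adj v u) :
    |(edgeCoverNumber H : ℤ) - (edgeCoverNumber G : ℤ)| ≤ 1 := by
  obtain ⟨a, b, c, d, ⟨-, hac, -, -, hbd, -, hab', hcd', -, -⟩, rfl⟩ := hsw
  have h₁ : edgeCoverNumber (switched G a b c d) ≤ edgeCoverNumber G + 1 := by
    refine edgeCoverNumber_le_succ_of_exchange (a := a) (b := b) (c := c) (d := d) hG ?_ ?_ ?_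
    · rintro e ⟨he, hne⟩
      rw [switched, edgeSet_fromEdgeSet]
      exact ⟨Or.inl ⟨he, hne⟩, G.not_isDiag_of_mem_edgeSet he⟩
    · simp [switched, hac]
    · simp [switched, hbd]
  have h₂ : edgeCoverNumber G ≤ edgeCoverNumber (switched G a b c d) + 1 := by
    refine edgeCoverNumber_le_succ_of_exchange (a := a) (b := c) (c := b) (d := d) hH ?_ hab' hcd'
    rintro e ⟨he, hne⟩
    rw [switched, edgeSet_fromEdgeSet] at he
    exact (he.1.resolve_right hne).1
  rw [abs_le]
  omega
end

section
/- Let F be a forest on a finite vertex set and let τ be a 2-switch on F such that τ(F) is again a forest. Then the rank (over the rationals) of the adjacency matrix of τ(F) differs from the rank of the adjacency matrix of F by either 0 or 2; equivalently, |rank(A(τ(F))) − rank(A(F))| ∈ {0, 2}, and the same holds for the nullities. -/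
open SimpleGraph

variable {V : Type*}

namespace Matrix

variable {m n K : Type*} [Fintype n] [Field K]

theorem rank_add_le_rank_add_rank [Finite m] (A B : Matrix m n K) :
    (A + B).rank ≤ A.rank + B.rank := by
  rw [rank, rank, rank, mulVecLin_add]
  exact (Submodule.finrank_mono (LinearMap.range_add_le _ _)).trans
    (Submodule.finrank_add_le_finrank_add_finrank _ _)

theorem rank_add_vecMulVec_add_vecMulVec_le [Finite m] (A : Matrix m n K)
    (u w : m → K) (v x : n → K) :
    (A + (vecMulVec u v + vecMulVec w x)).rank ≤ A.rank + 2 := by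
  have h₁ := rank_add_le_rank_add_rank A (vecMulVec u v + vecMulVec w x)
  have h₂ := rank_add_le_rank_add_rank (vecMulVec u v) (vecMulVec w x)
  have h₃ := rank_vecMulVec_le u v
  have h₄ := rank_vecMulVec_le w x
  omega

/-- A symmetric matrix that is exchanged by a symmetric projection with its complement has
even rank. -/
theorem IsSymm.even_rank_of_mul_eq_mul_one_sub [DecidableEq n] {A P : Matrix n n K}
    (hA : A.IsSymm) (hP : P.IsSymm) (hPP : P * P = P) (hPA : P * A = A * (1 - P)) :
    Even A.rank := by
  have hQA : (1 - P) * A = A * P := by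
    rw [Matrix.sub_mul, hPA, Matrix.mul_sub, Matrix.one_mul, Matrix.mul_one, sub_sub_cancel]
  have hrank : ((1 - P) * A).rank = (P * A).rank := by
    rw [hQA, ← rank_transpose, transpose_mul, hP.eq, hA.eq]
  have hsup : LinearMap.range (P * A).mulVecLin ⊔ LinearMap.range ((1 - P) * A).mulVecLin =
      LinearMap.range A.mulVecLin := by
    refine le_antisymm (sup_le ?_ ?_) ?_
    · rw [hPA, mulVecLin_mul]
      exact LinearMap.range_comp_le_range _ _
    · rw [hQA, mulVecLin_mul]
      exact LinearMap.range_comp_le_range _ _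
    · have hsum : A = P * A + (1 - P) * A := by
        rw [← Matrix.add_mul, add_sub_cancel, Matrix.one_mul]
      conv_lhs => rw [hsum, mulVecLin_add]
      exact LinearMap.range_add_le _ _
  have hinf : LinearMap.range (P * A).mulVecLin ⊓ LinearMap.range ((1 - P) * A).mulVecLin = ⊥ := by
    rw [eq_bot_iff]
    rintro y ⟨⟨u, hu⟩, ⟨v, hv⟩⟩
    rw [mulVecLin_apply] at hu hv
    have h₁ : P *ᵥ y = y := by
      rw [← hu, mulVec_mulVec, ← Matrix.mul_assoc, hPP]
    have h₂ : P *ᵥ y = 0 := by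
      rw [← hv, mulVec_mulVec, ← Matrix.mul_assoc, Matrix.mul_sub, hPP, Matrix.mul_one, sub_self,
        Matrix.zero_mul, zero_mulVec]
    exact (Submodule.mem_bot K).2 (h₁.symm.trans h₂)
  have hdim := Submodule.finrank_sup_add_finrank_inf_eq
    (LinearMap.range (P * A).mulVecLin) (LinearMap.range ((1 - P) * A).mulVecLin)
  rw [hsup, hinf, finrank_bot, add_zero] at hdim
  exact ⟨(P * A).rank, hdim.trans (congrArg _ hrank)⟩

end Matrix

namespace SimpleGraph

variable [Fintype V] [DecidableEq V]

theorem IsBipartite.even_rank_adjMatrix {G : SimpleGraph V} [DecidableRel G.Adj]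
    (hG : G.IsBipartite) (K : Type*) [Field K] : Even (G.adjMatrix K).rank := by
  obtain ⟨C⟩ := hG
  refine (G.isSymm_adjMatrix).even_rank_of_mul_eq_mul_one_sub
    (P := Matrix.diagonal fun v ↦ if C v = 0 then 1 else 0)
    (Matrix.isSymm_diagonal _) ?_ ?_
  · simp [Matrix.diagonal_mul_diagonal]
  · ext i j
    rw [Matrix.mul_sub, Matrix.sub_apply, Matrix.mul_one, Matrix.diagonal_mul,
      Matrix.mul_diagonal, adjMatrix_apply]
    by_cases h : G.Adj i j
    · have := C.valid h
      by_cases hi : C i = 0 <;> by_cases hj : C j = 0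
      · omega
      · simp [h, hi, hj]
      · simp [h, hi, hj]
      · omega
    · simp [h]

end SimpleGraph

theorem adjMatrix_eq_add_vecMulVec_of_isSwitchPair {K : Type*} [DecidableEq V] [Ring K]
    {G H : SimpleGraph V} [DecidableRel G.Adj] [DecidableRel H.Adj] {a b c d : V}
    (h : IsSwitchPair G a b c d) (hH : H = switched G a b c d) :
    H.adjMatrix K = G.adjMatrix K +
      (Matrix.vecMulVec (Pi.single a 1 - Pi.single d 1) (Pi.single c 1 - Pi.single b 1) +
        Matrix.vecMulVec (Pi.single c 1 - Pi.single b 1) (Pi.single a 1 - Pi.single d 1)) := by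
  obtain ⟨hab, hac, had, hbc, hbd, hcd, gab, gcd, gac, gbd⟩ := h
  have gba := gab.symm
  have gdc := gcd.symm
  have gca : ¬ G.Adj c a := fun h ↦ gac h.symm
  have gdb : ¬ G.Adj d b := fun h ↦ gbd h.symm
  ext i j
  have hadj : H.Adj i j ↔ ((G.Adj i j ∧ ¬ (s(i, j) = s(a, b) ∨ s(i, j) = s(c, d))) ∨
      (s(i, j) = s(a, c) ∨ s(i, j) = s(b, d))) := by
    simp only [hH, switched, fromEdgeSet_adj, Set.mem_union, Set.mem_sdiff, mem_edgeSet,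
      Set.mem_insert_iff, Set.mem_singleton_iff]
    refine and_iff_left_of_imp ?_
    rintro (h | h | h) rfl
    · exact h.1.ne rfl
    all_goals grind [Sym2.eq_iff]
  simp only [adjMatrix_apply, Matrix.add_apply, Matrix.vecMulVec_apply, Pi.sub_apply,
    Pi.single_apply, hadj, Sym2.eq_iff]
  by_cases hia : i = a
  · subst hia
    by_cases j = b <;> by_cases j = c <;> by_cases j = d <;> simp_all
  by_cases hib : i = b
  · subst hib
    by_cases j = a <;> by_cases j = c <;> by_cases j = d <;> simp_all
  by_cases hic : i = c
  · subst hic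
    by_cases j = a <;> by_cases j = b <;> by_cases j = d <;> simp_all
  by_cases hid : i = d
  · subst hid
    by_cases j = a <;> by_cases j = b <;> by_cases j = c <;> simp_all
  simp_all

/-- If `F` is a forest and a 2-switch transforms `F` into the forest `H`,
then the ranks (over `ℚ`) of their adjacency matrices differ by `0` or `2`, and so do
their nullities. -/
theorem rank_nullity_under_fswitch {V : Type*} [Fintype V] [DecidableEq V]
    (F H : SimpleGraph V) [DecidableRel F.Adj] [DecidableRel H.Adj]
    (hF : F.IsAcyclic) (hH : H.IsAcyclic) (hsw : TwoSwitch F H) :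
    |((H.adjMatrix ℚ).rank : ℤ) - ((F.adjMatrix ℚ).rank : ℤ)| ∈ ({0, 2} : Set ℤ) ∧
      |(Module.finrank ℚ (LinearMap.ker (H.adjMatrix ℚ).mulVecLin) : ℤ) -
        (Module.finrank ℚ (LinearMap.ker (F.adjMatrix ℚ).mulVecLin) : ℤ)| ∈
          ({0, 2} : Set ℤ) := by
  obtain ⟨a, b, c, d, h, hHF⟩ := hsw
  have hHE := adjMatrix_eq_add_vecMulVec_of_isSwitchPair (K := ℚ) h hHF
  have hle : (H.adjMatrix ℚ).rank ≤ (F.adjMatrix ℚ).rank + 2 :=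
    hHE ▸ Matrix.rank_add_vecMulVec_add_vecMulVec_le _ _ _ _ _
  have hge : (F.adjMatrix ℚ).rank ≤ (H.adjMatrix ℚ).rank + 2 := by
    have hFE := eq_sub_of_add_eq hHE.symm
    rw [sub_eq_add_neg, neg_add, ← Matrix.neg_vecMulVec, ← Matrix.neg_vecMulVec] at hFE
    conv_lhs => rw [hFE]
    exact Matrix.rank_add_vecMulVec_add_vecMulVec_le _ _ _ _ _
  obtain ⟨k, hk⟩ := hF.isBipartite.even_rank_adjMatrix ℚ
  obtain ⟨l, hl⟩ := hH.isBipartite.even_rank_adjMatrix ℚ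
  have hnF := (F.adjMatrix ℚ).mulVecLin.finrank_range_add_finrank_ker
  have hnH := (H.adjMatrix ℚ).mulVecLin.finrank_range_add_finrank_ker
  rw [← Matrix.rank] at hnF hnH
  simp only [Set.mem_insert_iff, Set.mem_singleton_iff, abs_eq_zero, abs_eq (zero_le_two (α := ℤ))]
  omega
end

section
/- Let G and H be two simple graphs on the same finite vertex set V such that deg_G(v) = deg_H(v) for every v ∈ V. Then the number of edges of G that are not edges of H is not equal to 1, i.e., |E(G) \ E(H)| ≠ 1. -/
open SimpleGraph

variable {V : Type*}

/-- If two sets in a finite type have the same cardinality and the first is not contained in the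
second, then the second is not contained in the first. -/
theorem exists_mem_notMem_of_ncard_eq {α : Type*} [Finite α] {s t : Set α}
    (hst : s.ncard = t.ncard) {x : α} (hxs : x ∈ s) (hxt : x ∉ t) :
    ∃ y ∈ t, y ∉ s := by
  by_contra! h
  exact hxt (Set.eq_of_subset_of_ncard_le h hst.le ▸ hxs)

/-- If `G` and `H` have the same degree sequence, then the number of
edges of `G` that are not edges of `H` is not equal to `1`. -/
theorem edge_difference_ne_one {V : Type*} [Fintype V]
    (G H : SimpleGraph V)
    (hdeg : ∀ v : V, (G.neighborSet v).ncard = (H.neighborSet v).ncard) :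
    (G.edgeSet \ H.edgeSet).ncard ≠ 1 := by
  intro h
  obtain ⟨e, he⟩ := Set.ncard_eq_one.mp h
  induction e with | _ a b
  have key (x y : V) : G.Adj x y ∧ ¬ H.Adj x y ↔ s(x, y) = s(a, b) := by
    simpa using Set.ext_iff.mp he s(x, y)
  obtain ⟨hG, hH⟩ := (key a b).mpr rfl
  obtain ⟨c, hHc, hGc⟩ := exists_mem_notMem_of_ncard_eq (hdeg a) hG hH
  obtain ⟨d, hGd, hHd⟩ :=
    exists_mem_notMem_of_ncard_eq (hdeg c).symm hHc.symm fun h' => hGc (SimpleGraph.Adj.symm h')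
  have hcd := (key c d).mp ⟨hGd, hHd⟩
  rcases Sym2.eq_iff.mp hcd with ⟨rfl, -⟩ | ⟨rfl, -⟩
  · exact H.irrefl hHc
  · exact hH hHc
end

section
/- Let G be a pseudoforest on a finite vertex set with at least one edge such that every connected component of G contains a cycle (i.e., cyc(G) = κ(G)). Then there exists a finite sequence of graphs G = G_0, G_1, ..., G_r such that every G_i is a pseudoforest, each G_{i+1} is obtained from G_i by a 2-switch, and G_r is a connected unicyclic graph. -/
open SimpleGraph

variable {V : Type*}

namespace SimpleGraph

variable {G F H : SimpleGraph V}

/-- If every edge of `G` met while walking from `u` joins vertices that are reachable from each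
other in `H`, then everything reachable from `u` in `G` is so in `H`. -/
lemma Reachable.of_forall_adj {u v : V} (huv : G.Reachable u v)
    (h : ∀ x y, H.Reachable u x → G.Adj x y → H.Reachable x y) : H.Reachable u v := by
  rw [reachable_iff_reflTransGen] at huv
  induction huv with
  | refl => rfl
  | tail _ hadj ih => exact ih.trans (h _ _ ih hadj)

lemma Walk.reachable_of_mem_support {u v w : V} (p : G.Walk u v) (hw : w ∈ p.support) :
    G.Reachable u w := by
  classical
  exact (p.takeUntil w hw).reachable

/-- `F` is a spanning forest of `G` with the same connected components as `G`, and every component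
contains exactly one edge of `G` that is not in `F`. -/
structure IsCyclicSpanningForest (G F : SimpleGraph V) : Prop where
  le : F ≤ G
  isAcyclic : F.IsAcyclic
  reachable : ∀ {u v : V}, G.Reachable u v → F.Reachable u v
  exists_adj : ∀ u : V, ∃ x y : V, F.Reachable u x ∧ G.Adj x y ∧ ¬ F.Adj x y
  unique : ∀ {x y z w : V}, G.Adj x y → ¬ F.Adj x y → G.Adj z w → ¬ F.Adj z w →
    F.Reachable x z → s(x, y) = s(z, w)

namespace IsCyclicSpanningForest

lemma mem_edges (h : IsCyclicSpanningForest G F) {u x y : V} {p : G.Walk u u} (hp : p.IsCycle)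
    (hux : F.Reachable u x) (hG : G.Adj x y) (hF : ¬ F.Adj x y) : s(x, y) ∈ p.edges := by
  by_contra hmem
  have key : ∀ e ∈ p.edges, e ∈ F.edgeSet := by
    intro e
    induction e with | _ z w
    intro he
    by_contra hzw
    have huz : G.Reachable u z := p.reachable_of_mem_support (p.fst_mem_support_of_mem_edges he)
    exact hmem (h.unique hG hF (p.adj_of_mem_edges he) hzw
      (hux.symm.trans (h.reachable huz)) ▸ he)
  exact h.isAcyclic _ (hp.transfer key)

lemma edges_subset (h : IsCyclicSpanningForest G F) {u v : V} {p : G.Walk u u} {q : G.Walk v v}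
    (hp : p.IsCycle) (hq : q.IsCycle) (huv : G.Reachable u v) {e : Sym2 V} (he : e ∈ p.edges) :
    e ∈ q.edges := by
  obtain ⟨x, y, hux, hG, hF⟩ := h.exists_adj u
  have hxq := h.mem_edges hq ((h.reachable huv).symm.trans hux) hG hF
  induction e with | _ z w
  by_contra hne
  have hzwxy : s(x, y) ≠ s(z, w) := fun hh ↦ hne (hh ▸ hxq)
  have huz : F.Reachable u z :=
    h.reachable (p.reachable_of_mem_support (p.fst_mem_support_of_mem_edges he))
  have hzw : F.Adj z w := by
    by_contra hzw
    exact hzwxy (h.unique hG hF (p.adj_of_mem_edges he) hzw (hux.symm.trans huz))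
  have hxy : (F.deleteEdges {s(z, w)}).Reachable x y := by
    have hq' : ∀ f ∈ q.edges, f ∈ (G.deleteEdges {s(z, w)}).edgeSet := by
      intro f hf
      rw [edgeSet_deleteEdges]
      exact ⟨q.edges_subset_edgeSet hf, fun hh ↦ hne (hh ▸ hf)⟩
    refine Reachable.of_forall_adj (adj_and_reachable_delete_edges_iff_exists_cycle.2
      ⟨v, q.transfer _ hq', hq.transfer hq', by simpa using hxq⟩).2 fun s t hs hst ↦ ?_
    simp only [deleteEdges_adj, Set.mem_singleton_iff] at hst
    refine Adj.reachable ?_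
    rw [deleteEdges_adj]
    refine ⟨?_, by simpa using hst.1.2⟩
    by_contra hFst
    exact hst.2 (h.unique hG hF hst.1.1 hFst (hs.mono (deleteEdges_le _))).symm
  refine isBridge_iff.1 (isAcyclic_iff_forall_adj_isBridge.1 h.isAcyclic hzw) ?_
  refine Reachable.of_forall_adj
    (adj_and_reachable_delete_edges_iff_exists_cycle.2 ⟨u, p, hp, he⟩).2 fun s t hs hst ↦ ?_
  rw [deleteEdges_adj] at hst
  by_cases hFst : F.Adj s t
  · exact Adj.reachable (deleteEdges_adj.2 ⟨hFst, hst.2⟩)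
  · have := h.unique hG hF hst.1 hFst
      ((hux.symm.trans huz).trans (hs.mono (deleteEdges_le _)))
    rcases Sym2.eq_iff.1 this with ⟨rfl, rfl⟩ | ⟨rfl, rfl⟩
    exacts [hxy, hxy.symm]

lemma isPseudoforest (h : IsCyclicSpanningForest G F) : IsPseudoforest G :=
  fun _ _ _ _ hp hq huv ↦ Set.ext fun _ ↦
    ⟨h.edges_subset hp hq huv, h.edges_subset hq hp huv.symm⟩

lemma exists_isCycle (h : IsCyclicSpanningForest G F) (u : V) :
    ∃ (v : V) (p : G.Walk v v), p.IsCycle := by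
  obtain ⟨x, y, -, hG, hF⟩ := h.exists_adj u
  by_contra! hc
  have hbr := isBridge_iff.1 (isAcyclic_iff_forall_adj_isBridge.1 (fun v p ↦ hc v p) hG)
  refine hbr ((h.reachable hG.reachable).mono fun s t hst ↦ ?_)
  rw [deleteEdges_adj]
  refine ⟨h.le hst, fun hh ↦ hF ?_⟩
  rwa [← mem_edgeSet, ← Set.mem_singleton_iff.1 hh]

lemma isUnicyclic (h : IsCyclicSpanningForest G F) (hG : G.Connected) : IsUnicyclic G := by
  obtain ⟨u⟩ := hG.nonempty
  obtain ⟨v, p, hp⟩ := h.exists_isCycle u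
  refine ⟨hG, {e | e ∈ p.edges}, ⟨v, p, hp, rfl⟩, ?_⟩
  rintro _ ⟨w, q, hq, rfl⟩
  exact h.isPseudoforest _ _ _ _ hq hp (hG.preconnected _ _)

end IsCyclicSpanningForest

lemma exists_isCyclicSpanningForest (hG : IsPseudoforest G)
    (hc : ∀ u, ∃ (v : V) (p : G.Walk v v), G.Reachable u v ∧ p.IsCycle) :
    ∃ F, IsCyclicSpanningForest G F := by
  obtain ⟨F, hle, hF, hreach⟩ := G.exists_isAcyclic_reachable_eq_le
  refine ⟨F, hle, hF, fun h ↦ hreach ▸ h, fun u ↦ ?_, fun {x y z w} hG₁ hF₁ hG₂ hF₂ hxz ↦ ?_⟩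
  · obtain ⟨v, p, huv, hp⟩ := hc u
    by_contra! hcon
    refine hF _ (hp.transfer (H := F) fun e ↦ ?_)
    induction e with | _ z w
    intro he
    refine hcon z w ?_ (p.adj_of_mem_edges he)
    rw [hreach]
    exact huv.trans (p.reachable_of_mem_support (p.fst_mem_support_of_mem_edges he))
  · have key : ∀ {x y : V}, G.Adj x y → ¬ F.Adj x y → ∃ p : G.Walk x x, p.IsCycle ∧
        s(x, y) ∈ p.edges ∧ ∀ e ∈ p.edges, e ≠ s(x, y) → e ∈ F.edgeSet := by
      intro x y hxy hFxy
      have hle' : F ⊔ edge x y ≤ G := sup_le hle ((edge_le_iff G).2 (Or.inr hxy))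
      have hr : ((F ⊔ edge x y).deleteEdges {s(x, y)}).Reachable x y := by
        have hxy' : F.Reachable x y := hreach ▸ hxy.reachable
        refine hxy'.mono fun s t hst ↦ ?_
        rw [deleteEdges_adj]
        refine ⟨Or.inl hst, fun hh ↦ hFxy ?_⟩
        rwa [← mem_edgeSet, ← Set.mem_singleton_iff.1 hh]
      classical
      obtain ⟨u, p, hp, hmem⟩ := adj_and_reachable_delete_edges_iff_exists_cycle.1
        ⟨Or.inr ((edge_adj ..).2 ⟨Or.inl ⟨rfl, rfl⟩, hxy.ne⟩), hr⟩
      have hx := p.fst_mem_support_of_mem_edges hmem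
      refine ⟨(p.rotate _ hx).mapLe hle', (hp.rotate hx).mapLe hle', ?_, ?_⟩
      · rw [Walk.edges_mapLe_eq_edges]
        exact (p.rotate_edges _ hx).mem_iff.2 hmem
      · intro e he hne
        rw [Walk.edges_mapLe_eq_edges] at he
        have := Walk.edges_subset_edgeSet _ he
        rw [edgeSet_sup, edgeSet_edge] at this
        exact this.resolve_right fun hh ↦ hne hh.1
    obtain ⟨p, hp, hmem, -⟩ := key hG₁ hF₁
    obtain ⟨q, hq, -, hq'⟩ := key hG₂ hF₂
    have heq := hG _ _ p q hp hq (hxz.mono hle)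
    by_contra hne
    exact hF₁ (hq' _ (heq.subset hmem) hne)

lemma switched_adj {a b c d x y : V} : (switched G a b c d).Adj x y ↔
    (G.Adj x y ∧ s(x, y) ≠ s(a, b) ∧ s(x, y) ≠ s(c, d) ∨
      s(x, y) = s(a, c) ∨ s(x, y) = s(b, d)) ∧ x ≠ y := by
  simp only [switched, fromEdgeSet_adj, Set.mem_union, Set.mem_sdiff, Set.mem_insert_iff,
    Set.mem_singleton_iff, mem_edgeSet, not_or, ne_eq]

lemma Reachable.of_sup_edge {a c x z : V} (h : (F ⊔ edge a c).Reachable x z)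
    (ha : ¬ F.Reachable x a) (hc : ¬ F.Reachable x c) : F.Reachable x z := by
  refine h.of_forall_adj fun s t hs hst ↦ ?_
  rcases hst with hst | hst
  · exact hst.reachable
  · rcases ((edge_adj ..).1 hst).1 with ⟨rfl, rfl⟩ | ⟨rfl, rfl⟩
    exacts [absurd hs ha, absurd hs hc]

/-- Switching the two non-forest edges of distinct components merges these components. -/
lemma IsCyclicSpanningForest.switched (h : IsCyclicSpanningForest G F) {a b c d : V}
    (hab : G.Adj a b) (hFab : ¬ F.Adj a b) (hcd : G.Adj c d) (hFcd : ¬ F.Adj c d)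
    (hac : ¬ F.Reachable a c) :
    IsSwitchPair G a b c d ∧
      IsCyclicSpanningForest (switched G a b c d) (F ⊔ edge a c) := by
  have rab : F.Reachable a b := h.reachable hab.reachable
  have rcd : F.Reachable c d := h.reachable hcd.reachable
  have had : ¬ F.Reachable a d := fun hh ↦ hac (hh.trans rcd.symm)
  have hbc : ¬ F.Reachable b c := fun hh ↦ hac (rab.trans hh)
  have hbd : ¬ F.Reachable b d := fun hh ↦ had (rab.trans hh)
  have ne : ∀ {x y}, ¬ F.Reachable x y → x ≠ y := by
    rintro x _ hxy rfl
    exact hxy .rfl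
  have nadj : ∀ {x y}, ¬ F.Reachable x y → ¬ G.Adj x y :=
    fun hxy hadj ↦ hxy (h.reachable hadj.reachable)
  have hle : F ≤ F ⊔ edge a c := le_sup_left
  have rac : (F ⊔ edge a c).Reachable a c :=
    Adj.reachable (Or.inr ((edge_adj ..).2 ⟨Or.inl ⟨rfl, rfl⟩, ne hac⟩))
  have rbd : (F ⊔ edge a c).Reachable b d := ((rab.mono hle).symm.trans rac).trans (rcd.mono hle)
  have nFbd : ¬ (F ⊔ edge a c).Adj b d := by
    rintro (hh | hh)
    · exact hbd hh.reachable
    · rcases ((edge_adj ..).1 hh).1 with ⟨hh, -⟩ | ⟨hh, -⟩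
      exacts [hab.ne hh.symm, ne hbc hh]
  have off : ∀ {x y : V}, (_root_.switched G a b c d).Adj x y → ¬ (F ⊔ edge a c).Adj x y →
      s(x, y) = s(b, d) ∨
        G.Adj x y ∧ ¬ F.Adj x y ∧ ¬ F.Reachable x a ∧ ¬ F.Reachable x c := by
    intro x y hxy hFxy
    obtain ⟨hxy, hne⟩ := switched_adj.1 hxy
    rcases hxy with ⟨hG, h₁, h₂⟩ | hxy | hxy
    · have hF : ¬ F.Adj x y := fun hh ↦ hFxy (hle hh)
      exact Or.inr ⟨hG, hF, fun hr ↦ h₁ (h.unique hG hF hab hFab hr),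
        fun hr ↦ h₂ (h.unique hG hF hcd hFcd hr)⟩
    · exact absurd (Or.inr ((adj_edge ..).2 ⟨hxy.symm, hne⟩)) hFxy
    · exact Or.inl hxy
  refine ⟨⟨hab.ne, ne hac, ne had, ne hbc, ne hbd, hcd.ne, hab, hcd, nadj hac, nadj hbd⟩,
    ?_, h.isAcyclic.sup_edge_of_not_reachable hac, ?_, ?_, ?_⟩
  · rintro x y (hxy | hxy)
    · refine switched_adj.2 ⟨Or.inl ⟨h.le hxy, fun hh ↦ hFab ?_, fun hh ↦ hFcd ?_⟩, hxy.ne⟩ <;>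
      rwa [← mem_edgeSet, ← hh]
    · obtain ⟨hh, hne⟩ := (adj_edge ..).1 hxy
      exact switched_adj.2 ⟨Or.inr (Or.inl hh.symm), hne⟩
  · intro u v huv
    refine huv.of_forall_adj fun s t _ hst ↦ ?_
    rcases (switched_adj.1 hst).1 with ⟨hG, -⟩ | hst | hst
    · exact (h.reachable hG.reachable).mono hle
    · rcases Sym2.eq_iff.1 hst with ⟨rfl, rfl⟩ | ⟨rfl, rfl⟩
      exacts [rac, rac.symm]
    · rcases Sym2.eq_iff.1 hst with ⟨rfl, rfl⟩ | ⟨rfl, rfl⟩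
      exacts [rbd, rbd.symm]
  · intro u
    have hbd' : (_root_.switched G a b c d).Adj b d :=
      switched_adj.2 ⟨Or.inr (Or.inr rfl), ne hbd⟩
    by_cases hua : F.Reachable u a
    · exact ⟨b, d, (hua.trans rab).mono hle, hbd', nFbd⟩
    by_cases huc : F.Reachable u c
    · exact ⟨b, d, ((huc.trans rcd).mono hle).trans rbd.symm, hbd', nFbd⟩
    obtain ⟨x, y, hux, hG, hF⟩ := h.exists_adj u
    have hxa : ¬ F.Reachable x a := fun hh ↦ hua (hux.trans hh)
    have hxc : ¬ F.Reachable x c := fun hh ↦ huc (hux.trans hh)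
    have rxy : F.Reachable x y := h.reachable hG.reachable
    refine ⟨x, y, hux.mono hle, switched_adj.2 ⟨Or.inl ⟨hG, fun hh ↦ ?_, fun hh ↦ ?_⟩, hG.ne⟩, ?_⟩
    · rcases Sym2.eq_iff.1 hh with ⟨rfl, -⟩ | ⟨-, rfl⟩
      exacts [hxa .rfl, hxa rxy]
    · rcases Sym2.eq_iff.1 hh with ⟨rfl, -⟩ | ⟨-, rfl⟩
      exacts [hxc .rfl, hxc rxy]
    · rintro (hh | hh)
      · exact hF hh
      · rcases ((edge_adj ..).1 hh).1 with ⟨rfl, -⟩ | ⟨rfl, -⟩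
        exacts [hxa .rfl, hxc .rfl]
  · have far : ∀ {x y z : V}, s(x, y) = s(b, d) → ¬ F.Reachable z a → ¬ F.Reachable z c →
        ¬ (F ⊔ edge a c).Reachable z x := by
      intro x y z hxy hza hzc hzx
      have hzx := hzx.of_sup_edge hza hzc
      rcases Sym2.eq_iff.1 hxy with ⟨rfl, -⟩ | ⟨rfl, -⟩
      exacts [hza (hzx.trans rab.symm), hzc (hzx.trans rcd.symm)]
    intro x y z w hG₁ hF₁ hG₂ hF₂ hxz
    rcases off hG₁ hF₁ with h₁ | ⟨g₁, f₁, xa, xc⟩ <;>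
    rcases off hG₂ hF₂ with h₂ | ⟨g₂, f₂, za, zc⟩
    · rw [h₁, h₂]
    · exact absurd hxz.symm (far h₁ za zc)
    · exact absurd hxz (far h₂ xa xc)
    · exact h.unique g₁ f₁ g₂ f₂ (hxz.of_sup_edge xa xc)

lemma IsCyclicSpanningForest.exists_twoSwitch_sequence [Finite V] [Nonempty V]
    (h : IsCyclicSpanningForest G F) :
    ∃ (r : ℕ) (Gs : Fin (r + 1) → SimpleGraph V),
      Gs 0 = G ∧
      (∀ i, IsPseudoforest (Gs i)) ∧
      (∀ i : Fin r, TwoSwitch (Gs i.castSucc) (Gs i.succ)) ∧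
      IsUnicyclic (Gs (Fin.last r)) := by
  induction F using WellFoundedGT.induction generalizing G with | _ F ih
  by_cases hconn : G.Preconnected
  · exact ⟨0, fun _ ↦ G, rfl, fun _ ↦ h.isPseudoforest, fun i ↦ i.elim0, h.isUnicyclic ⟨hconn⟩⟩
  · simp only [Preconnected, not_forall] at hconn
    obtain ⟨u, v, huv⟩ := hconn
    obtain ⟨a, b, hua, hab, hFab⟩ := h.exists_adj u
    obtain ⟨c, d, hvc, hcd, hFcd⟩ := h.exists_adj v
    have hac : ¬ F.Reachable a c := fun hh ↦ huv (((hua.trans hh).trans hvc.symm).mono h.le)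
    obtain ⟨hsw, h'⟩ := h.switched hab hFab hcd hFcd hac
    have hlt : F < F ⊔ edge a c := by
      refine lt_of_le_not_ge le_sup_left fun hle ↦ hac (Adj.reachable (hle (Or.inr ?_)))
      exact (edge_adj ..).2 ⟨Or.inl ⟨rfl, rfl⟩, hsw.2.1⟩
    obtain ⟨r, Gs, h0, hpf, hstep, hlast⟩ := ih _ hlt h'
    refine ⟨r + 1, Fin.cons G Gs, rfl, Fin.cases h.isPseudoforest hpf, fun i ↦ ?_, ?_⟩
    · cases i using Fin.cases with
      | zero => exact ⟨a, b, c, d, hsw, by simpa using h0⟩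
      | succ i => simpa [← Fin.succ_castSucc] using hstep i
    · simpa [← Fin.succ_last] using hlast

lemma exists_isCycle_of_cyc_eq_kappa [Finite V] (hcyc : cyc G = kappa G) (u : V) :
    ∃ (v : V) (p : G.Walk v v), G.Reachable u v ∧ p.IsCycle := by
  obtain ⟨⟨_, v, p, hv, hp⟩, hC⟩ :=
    (Subtype.val_injective.bijective_of_nat_card_le hcyc.ge).2 (G.connectedComponentMk u)
  exact ⟨v, p, (ConnectedComponent.exact (hv.trans hC)).symm, hp⟩

end SimpleGraph

/-- A pseudoforest with at least one edge, all of whose components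
contain a cycle, can be transformed into a connected unicyclic graph through a
sequence of 2-switches passing only through pseudoforests. -/
theorem pseudoforest_to_unicyclic {V : Type*} [Fintype V]
    (G : SimpleGraph V) (hG : IsPseudoforest G) (hne : G.edgeSet.Nonempty)
    (hcyc : cyc G = kappa G) :
    ∃ (r : ℕ) (Gs : Fin (r + 1) → SimpleGraph V),
      Gs 0 = G ∧
      (∀ i, IsPseudoforest (Gs i)) ∧
      (∀ i : Fin r, TwoSwitch (Gs i.castSucc) (Gs i.succ)) ∧
      IsUnicyclic (Gs (Fin.last r)) := by
  obtain ⟨e, he⟩ := hne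
  induction e with | _ a b
  have : Nonempty V := ⟨a⟩
  obtain ⟨F, hF⟩ := exists_isCyclicSpanningForest hG (exists_isCycle_of_cyc_eq_kappa hcyc)
  exact hF.exists_twoSwitch_sequence
end

section
/- Let F be a forest on a finite vertex set and let τ be any 2-switch on F. Then τ(F) is a pseudoforest, i.e., every connected component of τ(F) contains at most one cycle. -/
open SimpleGraph

variable {V : Type*}

/-- If the endpoints of every edge of `G` are joined by a walk in `K`, then reachability in `G`
implies reachability in `K`. -/
theorem SimpleGraph.Reachable.of_forall_adj_s18 {V : Type*} {G K : SimpleGraph V}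
    (h : ∀ x y, G.Adj x y → K.Reachable x y) {u v : V} (huv : G.Reachable u v) :
    K.Reachable u v := by
  obtain ⟨w⟩ := huv
  induction w with
  | nil => exact Reachable.refl _
  | cons hadj _ ih => exact (h _ _ hadj).trans ih

/-- If `K` contains all edges of a cycle except possibly `xy`, then `x` and `y` are joined by a
walk in `K`. -/
theorem SimpleGraph.Walk.IsCycle.reachable_of_mem_edges {V : Type*} {G K : SimpleGraph V} {u : V}
    {p : G.Walk u u} (hp : p.IsCycle) {x y : V} (hxy : s(x, y) ∈ p.edges)
    (hK : ∀ e ∈ p.edges, e ≠ s(x, y) → e ∈ K.edgeSet) : K.Reachable x y := by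
  have hmem : ∀ e ∈ p.edges, e ∈ (K ⊔ fromEdgeSet {s(x, y)}).edgeSet := by
    intro e he
    by_cases hexy : e = s(x, y)
    · subst hexy
      have hadj : G.Adj x y := p.edges_subset_edgeSet hxy
      simp [hadj.ne]
    · have := hK e he hexy
      rw [edgeSet_sup]
      exact Or.inl this
  by_contra hnr
  have hbridge : (K ⊔ fromEdgeSet {s(x, y)}).IsBridge s(x, y) := by
    refine isBridge_iff.2 fun h ↦ hnr (h.mono fun v w hvw ↦ ?_)
    simp only [deleteEdges_adj, sup_adj, fromEdgeSet_adj, Set.mem_singleton_iff] at hvw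
    tauto
  exact hbridge.notMem_edges_of_isCycle (hp.transfer hmem) (by simpa using hxy)

/-- Adding a single edge to a forest creates at most one cycle. -/
theorem SimpleGraph.IsAcyclic.edges_subset_of_isCycle_of_isCycle {V : Type*}
    {G H : SimpleGraph V} (hG : G.IsAcyclic) {x y : V}
    (hH : ∀ e ∈ H.edgeSet, e ≠ s(x, y) → e ∈ G.edgeSet) {u v : V} {p : H.Walk u u}
    {q : H.Walk v v} (hp : p.IsCycle) (hq : q.IsCycle) {e : Sym2 V} (he : e ∈ p.edges) :
    e ∈ q.edges := by
  have hxy : s(x, y) ∈ q.edges := by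
    by_contra hxy
    exact hG _ (hq.transfer fun f hf ↦
      hH f (q.edges_subset_edgeSet hf) fun h ↦ hxy (h ▸ hf))
  by_contra heq
  have hne : e ≠ s(x, y) := fun h ↦ heq (h ▸ hxy)
  induction e with | _ a b
  have hadj : G.Adj a b := hH _ (p.edges_subset_edgeSet he) hne
  have hxy' : (G.deleteEdges {s(a, b)}).Reachable x y := by
    refine hq.reachable_of_mem_edges hxy fun f hf hfne ↦ ?_
    rw [edgeSet_deleteEdges]
    exact ⟨hH f (q.edges_subset_edgeSet hf) hfne, fun h ↦ heq (h ▸ hf)⟩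
  have hab : (H.deleteEdges {s(a, b)}).Reachable a b := by
    refine hp.reachable_of_mem_edges he fun f hf hfne ↦ ?_
    rw [edgeSet_deleteEdges]
    exact ⟨p.edges_subset_edgeSet hf, hfne⟩
  refine (isBridge_iff.1 (isAcyclic_iff_forall_adj_isBridge.1 hG hadj)) ?_
  refine hab.of_forall_adj_s18 fun v w hvw ↦ ?_
  rw [deleteEdges_adj] at hvw
  by_cases h : s(v, w) = s(x, y)
  · rcases Sym2.eq_iff.1 h with ⟨rfl, rfl⟩ | ⟨rfl, rfl⟩
    exacts [hxy', hxy'.symm]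
  · exact Adj.reachable (deleteEdges_adj.2 ⟨hH _ hvw.1 h, hvw.2⟩)

/-- A graph obtained from a forest by adding at most one edge is a pseudoforest. -/
theorem SimpleGraph.IsAcyclic.isPseudoforest_of_edgeSet {V : Type*} {G H : SimpleGraph V}
    (hG : G.IsAcyclic) {x y : V} (hH : ∀ e ∈ H.edgeSet, e ≠ s(x, y) → e ∈ G.edgeSet) :
    IsPseudoforest H := fun _ _ _ _ hp hq _ ↦
  Set.Subset.antisymm (fun _ he ↦ hG.edges_subset_of_isCycle_of_isCycle hH hp hq he)
    (fun _ he ↦ hG.edges_subset_of_isCycle_of_isCycle hH hq hp he)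

/-- Applying any 2-switch to a forest yields a pseudoforest. -/
theorem twoSwitch_of_forest_isPseudoforest {V : Type*} [Fintype V]
    (F H : SimpleGraph V) (hF : F.IsAcyclic) (hsw : TwoSwitch F H) :
    IsPseudoforest H := by
  obtain ⟨a, b, c, d, ⟨-, hac, -, hbc, -, -, adj_ab, adj_cd, -, -⟩, rfl⟩ := hsw
  set K := F.deleteEdges {s(a, b), s(c, d)} with hK_def
  have hK : K.IsAcyclic := hF.anti (deleteEdges_le _)
  by_cases hr : K.Reachable a c
  · have hr' : ¬ K.Reachable b d := by
      intro hr'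
      have hle : K ≤ F.deleteEdges {s(a, b)} := deleteEdges_anti (by simp)
      have hdc : (F.deleteEdges {s(a, b)}).Adj c d := by
        rw [deleteEdges_adj]
        refine ⟨adj_cd, ?_⟩
        simp [hac.symm, hbc.symm]
      exact isBridge_iff.1 (isAcyclic_iff_forall_adj_isBridge.1 hF adj_ab)
        (((hr.mono hle).trans hdc.reachable).trans (hr'.mono hle).symm)
    refine (hK.sup_edge_of_not_reachable hr').isPseudoforest_of_edgeSet (x := a) (y := c) ?_
    intro e he hne
    induction e with | _ v w
    simp only [switched, mem_edgeSet, fromEdgeSet_adj, sup_adj, edge, hK_def,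
      deleteEdges_adj, Set.mem_union, Set.mem_sdiff, Set.mem_insert_iff,
      Set.mem_singleton_iff] at he ⊢
    clear * - he hne
    tauto
  · refine (hK.sup_edge_of_not_reachable hr).isPseudoforest_of_edgeSet (x := b) (y := d) ?_
    intro e he hne
    induction e with | _ v w
    simp only [switched, mem_edgeSet, fromEdgeSet_adj, sup_adj, edge, hK_def,
      deleteEdges_adj, Set.mem_union, Set.mem_sdiff, Set.mem_insert_iff,
      Set.mem_singleton_iff] at he ⊢
    clear * - he hne
    tauto
end

section
/- Let U be a unicyclic graph on a finite vertex set and let τ be a 2-switch on U deleting the edges e1 and e2, where e1 lies on the unique cycle of U and e2 does not lie on any cycle of U. Then τ(U) is again a unicyclic graph. -/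
open SimpleGraph

variable {V : Type*}

namespace SimpleGraph

/-- A cycle through the edge `xy` has the edge set of `xy` together with a path from `y` to `x`
avoiding that edge. -/
theorem Walk.IsCycle.exists_isPath_of_mem_edges {G : SimpleGraph V} {u x y : V} {w : G.Walk u u}
    (hw : w.IsCycle) (he : s(x, y) ∈ w.edges) :
    ∃ p : G.Walk y x, p.IsPath ∧ s(x, y) ∉ p.edges ∧
      ∀ e, e ∈ w.edges ↔ e = s(x, y) ∨ e ∈ p.edges := by
  classical
  have hx := w.fst_mem_support_of_mem_edges he
  have hmem : ∀ e, e ∈ (w.rotate x hx).edges ↔ e ∈ w.edges :=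
    fun e => (w.rotate_edges x hx).mem_iff
  suffices H : ∃ w' : G.Walk x x, w'.IsCycle ∧ (∀ e, e ∈ w'.edges ↔ e ∈ w.edges) ∧
      w'.snd = y by
    obtain ⟨w', hc, hm, hs⟩ := H
    cases w' with
    | nil => exact (hc.ne_nil rfl).elim
    | cons h p =>
      simp only [Walk.snd_cons] at hs
      subst hs
      rw [Walk.cons_isCycle_iff] at hc
      exact ⟨p, hc.1, hc.2, fun e => by rw [← hm, Walk.edges_cons, List.mem_cons]⟩
  have hc : (w.rotate x hx).IsCycle := (Walk.isCycle_rotate hx).2 hw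
  have he' := (hmem _).2 he
  generalize w.rotate x hx = w' at hc he' hmem
  by_cases hs : w'.snd = y
  · exact ⟨w', hc, hmem, hs⟩
  refine ⟨w'.reverse, hc.reverse, fun e => by rw [Walk.edges_reverse, List.mem_reverse, hmem], ?_⟩
  cases w' with
  | nil => exact (hc.ne_nil rfl).elim
  | cons h p =>
    simp only [Walk.snd_cons] at hs
    rw [Walk.cons_isCycle_iff] at hc
    have hp : s(x, y) ∈ p.edges := by
      rw [Walk.edges_cons, List.mem_cons] at he'
      refine he'.resolve_left fun heq => ?_
      have := h.ne
      grind
    have hnil : ¬ p.Nil := Walk.not_nil_of_ne h.ne'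
    rw [Walk.snd_reverse, Walk.penultimate_cons_of_not_nil _ _ hnil,
      hc.1.eq_penultimate_of_mem_edges hp]

/-- Every vertex is joined to an endpoint of a deleted edge. -/
theorem Connected.reachable_deleteEdges_singleton_or {G : SimpleGraph V} (hG : G.Connected)
    (c d v : V) :
    (G.deleteEdges {s(c, d)}).Reachable v c ∨ (G.deleteEdges {s(c, d)}).Reachable v d := by
  obtain ⟨p⟩ := hG.preconnected v c
  clear hG
  induction p with
  | nil => exact Or.inl .rfl
  | @cons u v w h p ih =>
    by_cases he : s(u, v) = s(w, d)
    · rcases Sym2.eq_iff.1 he with ⟨rfl, -⟩ | ⟨rfl, -⟩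
      · exact Or.inl .rfl
      · exact Or.inr .rfl
    · have hadj : (G.deleteEdges {s(w, d)}).Adj u v := by simpa [deleteEdges_adj, h] using he
      exact ih.imp hadj.reachable.trans hadj.reachable.trans

/-- In a tree, an edge `cd` may be replaced by `bd` for any `b` on the side of `c`. -/
theorem IsTree.isTree_deleteEdges_sup_edge {T : SimpleGraph V} (hT : T.IsTree) {b c d : V}
    (hcd : T.Adj c d) (hbc : (T.deleteEdges {s(c, d)}).Reachable b c) :
    (T.deleteEdges {s(c, d)} ⊔ edge b d).IsTree := by
  have hnr : ¬ (T.deleteEdges {s(c, d)}).Reachable c d :=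
    isBridge_iff.1 (isAcyclic_iff_forall_isBridge.1 hT.isAcyclic hcd)
  have hbd : ¬ (T.deleteEdges {s(c, d)}).Reachable b d := fun h => hnr (hbc.symm.trans h)
  have hle : T.deleteEdges {s(c, d)} ≤ T.deleteEdges {s(c, d)} ⊔ edge b d := le_sup_left
  have hne : b ≠ d := fun h => hbd (h ▸ .rfl)
  have hadj : (T.deleteEdges {s(c, d)} ⊔ edge b d).Adj b d :=
    Or.inr ((edge_adj ..).2 ⟨Or.inl ⟨rfl, rfl⟩, hne⟩)
  have hd : ∀ v, (T.deleteEdges {s(c, d)} ⊔ edge b d).Reachable v d := fun v =>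
    (hT.connected.reachable_deleteEdges_singleton_or c d v).elim
      (fun h => ((h.trans hbc.symm).mono hle).trans hadj.reachable) (fun h => h.mono hle)
  have := hT.connected.nonempty
  exact ⟨⟨fun u v => (hd u).trans (hd v).symm⟩,
    (hT.isAcyclic.anti (deleteEdges_le _)).sup_edge_of_not_reachable hbd⟩

end SimpleGraph

/-- Deleting an edge of the cycle of a unicyclic graph leaves a tree. -/
theorem IsUnicyclic.isTree_deleteEdges {G : SimpleGraph V} (hG : IsUnicyclic G) {x y u : V}
    {w : G.Walk u u} (hw : w.IsCycle) (he : s(x, y) ∈ w.edges) :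
    (G.deleteEdges {s(x, y)}).IsTree := by
  refine ⟨hG.1.connected_delete_edge_of_not_isBridge fun hb => hb.notMem_edges_of_isCycle hw he,
    fun v q hq => ?_⟩
  have hle := G.deleteEdges_le {s(x, y)}
  have hset := hG.2.unique ⟨v, q.mapLe hle, hq.mapLe hle, rfl⟩ ⟨u, w, hw, rfl⟩
  have hmem : s(x, y) ∈ q.edges := by
    have : s(x, y) ∈ {e | e ∈ (q.mapLe hle).edges} := hset ▸ he
    simpa using this
  simpa using q.edges_subset_edgeSet hmem

/-- A graph with an edge whose deletion leaves a tree is unicyclic. -/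
theorem isUnicyclic_of_isTree_deleteEdges {G : SimpleGraph V} {x y : V} (hxy : G.Adj x y)
    (hT : (G.deleteEdges {s(x, y)}).IsTree) : IsUnicyclic G := by
  obtain ⟨u, w, hw, -⟩ := adj_and_reachable_delete_edges_iff_exists_cycle.1
    ⟨hxy, hT.connected.preconnected x y⟩
  refine ⟨hT.connected.mono (G.deleteEdges_le _), _, ⟨u, w, hw, rfl⟩, ?_⟩
  have key : ∀ (v : V) (q : G.Walk v v), q.IsCycle →
      ∃ p : (G.deleteEdges {s(x, y)}).Walk y x, p.IsPath ∧
        {e | e ∈ q.edges} = {e | e = s(x, y) ∨ e ∈ p.edges} := by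
    intro v q hq
    have he : s(x, y) ∈ q.edges := by
      by_contra hne
      exact hT.isAcyclic _ (hq.toDeleteEdges G {s(x, y)} fun e h h' => hne (h' ▸ h))
    obtain ⟨p, hp, hne, hmem⟩ := hq.exists_isPath_of_mem_edges he
    refine ⟨p.toDeleteEdges {s(x, y)} fun e h h' => hne (h' ▸ h), hp.toDeleteEdges _ _ _, ?_⟩
    ext e
    simp [hmem]
  rintro _ ⟨v, q, hq, rfl⟩
  obtain ⟨p, hp, hpe⟩ := key u w hw
  obtain ⟨p', hp', hpe'⟩ := key v q hq
  obtain rfl : p = p' := (hT.existsUnique_path y x).unique hp hp'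
  rw [hpe, hpe']

theorem isUnicyclic_switched {U : SimpleGraph V} (hU : IsUnicyclic U) {a b c d : V}
    (hsw : IsSwitchPair U a b c d)
    (hab : ∃ s : Set (Sym2 V), IsCycleEdgeSet U s ∧ s(a, b) ∈ s)
    (hcd : ∀ s : Set (Sym2 V), IsCycleEdgeSet U s → s(c, d) ∉ s) :
    IsUnicyclic (switched U a b c d) := by
  obtain ⟨nab, nac, nad, nbc, nbd, ncd, adjab, adjcd, nadjac, nadjbd⟩ := hsw
  obtain ⟨_, ⟨u, w, hw, rfl⟩, he⟩ := hab
  have hcdw : s(c, d) ∉ w.edges := hcd _ ⟨u, w, hw, rfl⟩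
  have hT := hU.isTree_deleteEdges hw he
  have hTcd : (U.deleteEdges {s(a, b)}).Adj c d := by
    simp [deleteEdges_adj, adjcd, nac.symm, nbc.symm]
  have hFab : ((U.deleteEdges {s(a, b)}).deleteEdges {s(c, d)}).Reachable a b := by
    have h := (adj_and_reachable_delete_edges_iff_exists_cycle.2
      ⟨u, w.toDeleteEdges {s(c, d)} fun e h h' => hcdw (h' ▸ h), hw.toDeleteEdges _ _ _,
        by simpa using he⟩).2
    rwa [deleteEdges_deleteEdges, Set.union_comm, ← deleteEdges_deleteEdges] at h
  rcases hT.connected.reachable_deleteEdges_singleton_or c d a with hac | had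
  · refine isUnicyclic_of_isTree_deleteEdges (x := a) (y := c) (by simp [switched, nac]) ?_
    convert hT.isTree_deleteEdges_sup_edge hTcd (hFab.symm.trans hac) using 1
    ext x y
    simp only [switched, deleteEdges_adj, fromEdgeSet_adj, sup_adj, edge_adj, Set.mem_union,
      Set.mem_sdiff, Set.mem_insert_iff, Set.mem_singleton_iff, mem_edgeSet, Sym2.eq_iff]
    have := U.ne_of_adj (a := x) (b := y)
    have := U.adj_comm a c
    grind
  · refine isUnicyclic_of_isTree_deleteEdges (x := b) (y := d) (by simp [switched, nbd]) ?_
    rw [Sym2.eq_swap (a := c)] at had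
    convert hT.isTree_deleteEdges_sup_edge hTcd.symm had using 1
    ext x y
    simp only [switched, deleteEdges_adj, fromEdgeSet_adj, sup_adj, edge_adj, Set.mem_union,
      Set.mem_sdiff, Set.mem_insert_iff, Set.mem_singleton_iff, mem_edgeSet, Sym2.eq_iff]
    have := U.ne_of_adj (a := x) (b := y)
    have := U.adj_comm b d
    grind

/-- If `U` is unicyclic and a 2-switch deletes the edges `e1, e2`, where
`e1` lies on the (unique) cycle of `U` and `e2` lies on no cycle of `U`, then the
resulting graph is again unicyclic. -/
theorem uswitch_cycle_forest_edge {V : Type*} [Fintype V]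
    (U : SimpleGraph V) (hU : IsUnicyclic U) (a b c d : V)
    (hsw : IsSwitchPair U a b c d)
    (h : ∃ e₁ e₂ : Sym2 V, ({e₁, e₂} : Set (Sym2 V)) = {s(a, b), s(c, d)} ∧
      (∃ s : Set (Sym2 V), IsCycleEdgeSet U s ∧ e₁ ∈ s) ∧
      (∀ s : Set (Sym2 V), IsCycleEdgeSet U s → e₂ ∉ s)) :
    IsUnicyclic (switched U a b c d) := by
  obtain ⟨e₁, e₂, heq, h₁, h₂⟩ := h
  rcases Set.pair_eq_pair_iff.1 heq with ⟨rfl, rfl⟩ | ⟨rfl, rfl⟩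
  · exact isUnicyclic_switched hU hsw h₁ h₂
  · have hswap : switched U a b c d = switched U c d a b := by
      simp only [switched, Set.pair_comm s(a, b), Sym2.eq_swap (a := c) (b := a),
        Sym2.eq_swap (a := d) (b := b)]
    obtain ⟨nab, nac, nad, nbc, nbd, ncd, adjab, adjcd, nadjac, nadjbd⟩ := hsw
    rw [hswap]
    exact isUnicyclic_switched hU ⟨ncd, nac.symm, nbc.symm, nad.symm, nbd.symm, nab, adjcd, adjab,
      fun h => nadjac h.symm, fun h => nadjbd h.symm⟩ h₁ h₂
end
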